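/- arXiv:2010.10205 — 9 statements merged into one kernel-verified Lean document; each statement's English description precedes it below -/
import Mathlib

section
/- Let P = {x ∈ ℝ^n : A x ≤ b} be a polyhedron with nonempty interior (A an m×n real matrix, b ∈ ℝ^m), let c ∈ ℝ^n be such that −c lies in the interior of the polar cone of the recession cone of P, and let μ > 0. Then the function x ↦ ⟨c, x⟩ + μ·f*_P(x) attains a unique minimum over the interior of P, and this minimizer equals (∫_P e^{−⟨c,x⟩/μ} dx)^{−1} · ∫_P e^{−⟨c,x⟩/μ} x dx (integrals with respect to Lebesgue measure on ℝ^n). -/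
open MeasureTheory Real
open Filter Topology ProbabilityTheory

/-- An exponential in the norm with negative rate is integrable on a finite-dimensional space. -/
lemma integrable_exp_neg_mul_norm {E : Type*} [NormedAddCommGroup E] [NormedSpace ℝ E]
    [FiniteDimensional ℝ E] [MeasurableSpace E] [BorelSpace E] (ρ : Measure E)
    [ρ.IsAddHaarMeasure] {a : ℝ} (ha : 0 < a) :
    Integrable (fun x : E => exp (-(a * ‖x‖))) ρ := by
  set k : ℕ := Module.finrank ℝ E + 1 with hk
  have hint : Integrable (fun x : E => (1 + ‖x‖) ^ (-(k : ℝ))) ρ :=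
    integrable_one_add_norm (by rw [hk]; push_cast; linarith)
  refine (hint.const_mul (exp a * k.factorial / a ^ k)).mono' (by fun_prop) (ae_of_all _ ?_)
  intro x
  have hx : 0 < 1 + ‖x‖ := by positivity
  have h := pow_div_factorial_le_exp (x := a * (1 + ‖x‖)) (by positivity) k
  have hexp : exp (a * (1 + ‖x‖)) * exp (-(a * ‖x‖)) = exp a := by
    rw [← exp_add]; ring_nf
  rw [norm_of_nonneg (exp_pos _).le, rpow_neg hx.le, rpow_natCast, ← hexp, ← div_eq_mul_inv,
    le_div_iff₀ (by positivity), le_div_iff₀ (by positivity)]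
  rw [div_le_iff₀ (by positivity), mul_pow] at h
  nlinarith [mul_le_mul_of_nonneg_right h (exp_pos (-(a * ‖x‖))).le]

lemma dotProduct_le_sum_abs_mul_norm {ι : Type*} [Fintype ι] (w v : ι → ℝ) :
    w ⬝ᵥ v ≤ (∑ i, |w i|) * ‖v‖ := by
  rw [dotProduct, Finset.sum_mul]
  refine Finset.sum_le_sum fun i _ => (le_abs_self _).trans ?_
  rw [abs_mul]
  exact mul_le_mul_of_nonneg_left (norm_le_pi_norm v i) (abs_nonneg _)

/-- If a linear functional decays linearly in the norm on `P`, then the exponentials of all nearby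
linear functionals are integrable on `P`. -/
lemma eventually_integrable_exp_dotProduct {ι : Type*} [Fintype ι] {P : Set (ι → ℝ)}
    (hPm : MeasurableSet P) {θ₀ : ι → ℝ} {a R : ℝ} (ha : 0 < a)
    (hle : ∀ x ∈ P, θ₀ ⬝ᵥ x ≤ R - a * ‖x‖) :
    ∀ᶠ θ in 𝓝 θ₀, Integrable (fun x => exp (θ ⬝ᵥ x)) (volume.restrict P) := by
  have hcont : Continuous fun θ : ι → ℝ => ∑ i, |(θ - θ₀) i| := by fun_prop
  have hlim : Tendsto (fun θ : ι → ℝ => ∑ i, |(θ - θ₀) i|) (𝓝 θ₀) (𝓝 0) := by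
    simpa using hcont.tendsto θ₀
  filter_upwards [hlim.eventually_lt_const (half_pos ha)] with θ hθ
  refine (((integrable_exp_neg_mul_norm volume (half_pos ha)).const_mul (exp R)).restrict).mono'
    (by fun_prop) ?_
  filter_upwards [ae_restrict_mem hPm] with x hx
  rw [norm_of_nonneg (exp_pos _).le, ← exp_add, exp_le_exp]
  have h := dotProduct_le_sum_abs_mul_norm (θ - θ₀) x
  rw [sub_dotProduct] at h
  nlinarith [hle x hx, mul_le_mul_of_nonneg_right hθ.le (norm_nonneg x)]

/-- A linear functional in the interior of the polar cone of the cone `{u | A u ≤ 0}` decays at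
least linearly in the norm on the polyhedron `{x | A x ≤ b}`. -/
lemma exists_dotProduct_le_sub_norm {ι κ : Type*} [Fintype ι] (A : Matrix κ ι ℝ) (b : κ → ℝ)
    {y : ι → ℝ}
    (hy : y ∈ interior {y : ι → ℝ | ∀ u, (∀ i, A i ⬝ᵥ u ≤ 0) → y ⬝ᵥ u ≤ 0}) :
    ∃ a > 0, ∃ R, ∀ x, (∀ i, A i ⬝ᵥ x ≤ b i) → y ⬝ᵥ x ≤ R - a * ‖x‖ := by
  obtain ⟨δ, hδ, hball⟩ := Metric.mem_nhds_iff.1 (mem_interior_iff_mem_nhds.1 hy)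
  have hneg : ∀ u, (∀ i, A i ⬝ᵥ u ≤ 0) → u ≠ 0 → y ⬝ᵥ u < 0 := by
    intro u hu hu0
    have hnear : ∀ᶠ t : ℝ in 𝓝[>] 0, y + t • u ∈ Metric.ball y δ := by
      have hc : Tendsto (fun t : ℝ => y + t • u) (𝓝 0) (𝓝 y) := by
        have : Continuous fun t : ℝ => y + t • u := by fun_prop
        simpa using this.tendsto 0
      exact (hc.mono_left nhdsWithin_le_nhds) (Metric.ball_mem_nhds y hδ)
    obtain ⟨t, ht, ht0⟩ := (hnear.and self_mem_nhdsWithin).exists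
    have h := hball ht u hu
    rw [add_dotProduct, smul_dotProduct, smul_eq_mul] at h
    have hpos : 0 < u ⬝ᵥ u :=
      lt_of_le_of_ne (Finset.sum_nonneg fun i _ => mul_self_nonneg (u i))
        fun h0 => hu0 (dotProduct_self_eq_zero.1 h0.symm)
    nlinarith [mul_pos ht0 hpos]
  by_contra! hcon
  have hseq : ∀ k : ℕ, ∃ x, (∀ i, A i ⬝ᵥ x ≤ b i) ∧
      (k : ℝ) - ((k : ℝ) + 1)⁻¹ * ‖x‖ < y ⬝ᵥ x :=
    fun k => hcon ((k : ℝ) + 1)⁻¹ (by positivity) k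
  choose x hxA hxy using hseq
  have hinv : Tendsto (fun k : ℕ => ((k : ℝ) + 1)⁻¹) atTop (𝓝 0) := by
    simpa [one_div] using tendsto_one_div_add_atTop_nhds_zero_nat (𝕜 := ℝ)
  obtain ⟨C, hC⟩ : ∃ C : ℝ, ∀ v : ι → ℝ, y ⬝ᵥ v ≤ C * ‖v‖ :=
    ⟨_, dotProduct_le_sum_abs_mul_norm y⟩
  have hxnorm : Tendsto (fun k => ‖x k‖) atTop atTop := by
    have hC1 : 0 < |C| + 1 := by positivity
    refine tendsto_atTop_mono (f := fun k : ℕ => (k : ℝ) / (|C| + 1)) (fun k => ?_)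
      (tendsto_natCast_atTop_atTop.atTop_div_const hC1)
    rw [div_le_iff₀ hC1]
    have h1 : ((k : ℝ) + 1)⁻¹ ≤ 1 := inv_le_one_of_one_le₀ (by linarith [k.cast_nonneg (α := ℝ)])
    nlinarith [hxy k, hC (x k), norm_nonneg (x k), le_abs_self C]
  obtain ⟨u, hu, φ, hφ, hlim⟩ := (isCompact_closedBall (0 : ι → ℝ) 1).tendsto_subseq
    (x := fun k => ‖x k‖⁻¹ • x k) (fun k => by
      rw [mem_closedBall_zero_iff, norm_smul, norm_inv, norm_norm]
      exact inv_mul_le_one)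
  have hnφ : Tendsto (fun k => ‖x (φ k)‖) atTop atTop := hxnorm.comp hφ.tendsto_atTop
  have hpos : ∀ᶠ k in atTop, 0 < ‖x (φ k)‖ := hnφ.eventually_gt_atTop 0
  have hdot : ∀ v : ι → ℝ,
      Tendsto (fun k => ‖x (φ k)‖⁻¹ * (v ⬝ᵥ x (φ k))) atTop (𝓝 (v ⬝ᵥ u)) := by
    intro v
    have hcont : Continuous fun w : ι → ℝ => v ⬝ᵥ w := by fun_prop
    refine ((hcont.tendsto u).comp hlim).congr fun k => ?_
    simp [dotProduct_smul]
  have hunorm : ‖u‖ = 1 := by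
    refine tendsto_nhds_unique hlim.norm (tendsto_const_nhds.congr' ?_)
    filter_upwards [hpos] with k hk
    simp [norm_smul, hk.ne']
  have hAu : ∀ i, A i ⬝ᵥ u ≤ 0 := by
    intro i
    have h0 : Tendsto (fun k => ‖x (φ k)‖⁻¹ * b i) atTop (𝓝 0) := by
      simpa using hnφ.inv_tendsto_atTop.mul_const (b i)
    exact le_of_tendsto_of_tendsto' (hdot (A i)) h0
      fun k => mul_le_mul_of_nonneg_left (hxA _ i) (by positivity)
  have hyu : 0 ≤ y ⬝ᵥ u := by
    have h0 : Tendsto (fun k => -((φ k : ℝ) + 1)⁻¹) atTop (𝓝 0) := by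
      simpa using (hinv.comp hφ.tendsto_atTop).neg
    refine le_of_tendsto_of_tendsto h0 (hdot y) ?_
    filter_upwards [hpos] with k hk
    rw [inv_mul_eq_div, le_div_iff₀ hk]
    linarith [hxy (φ k), (φ k).cast_nonneg (α := ℝ)]
  exact absurd (hneg u hAu (by rintro rfl; simp at hunorm)) hyu.not_gt

section GibbsMeasure

variable {ι : Type*} [Fintype ι] {ρ : Measure (ι → ℝ)} {θ₀ : ι → ℝ}

lemma zero_mem_interior_integrableExpSet_tilted
    (hθ₀ : ∀ᶠ θ in 𝓝 θ₀, Integrable (fun x => exp (θ ⬝ᵥ x)) ρ) (w : ι → ℝ) :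
    0 ∈ interior (integrableExpSet (fun x => w ⬝ᵥ x) (ρ.tilted fun x => θ₀ ⬝ᵥ x)) := by
  have hlim : Tendsto (fun t : ℝ => θ₀ + t • w) (𝓝 0) (𝓝 θ₀) := by
    have : Continuous fun t : ℝ => θ₀ + t • w := by fun_prop
    simpa using this.tendsto 0
  rw [mem_interior_iff_mem_nhds]
  filter_upwards [hlim.eventually hθ₀] with t ht
  rw [integrableExpSet, Set.mem_ofPred_eq, integrable_tilted_iff hθ₀.self_of_nhds]
  refine ht.congr (ae_of_all _ fun x => ?_)
  simp [add_dotProduct, exp_add]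

lemma integrable_id_tilted
    (hθ₀ : ∀ᶠ θ in 𝓝 θ₀, Integrable (fun x => exp (θ ⬝ᵥ x)) ρ) :
    Integrable (fun x : ι → ℝ => x) (ρ.tilted fun x => θ₀ ⬝ᵥ x) := by
  classical
  refine Integrable.of_eval fun i => ?_
  simpa using integrable_of_mem_interior_integrableExpSet
    (zero_mem_interior_integrableExpSet_tilted hθ₀ (Pi.single i 1))

lemma integral_dotProduct {ν : Measure (ι → ℝ)} (hν : Integrable (fun x => x) ν) (w : ι → ℝ) :
    ∫ x, w ⬝ᵥ x ∂ν = w ⬝ᵥ ∫ x, x ∂ν := by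
  simp only [dotProduct]
  rw [integral_finsetSum _ fun i _ => (hν.eval i).const_mul (w i)]
  refine Finset.sum_congr rfl fun i _ => ?_
  rw [integral_const_mul, eval_integral hν.eval]

lemma integrable_dotProduct {ν : Measure (ι → ℝ)} (hν : Integrable (fun x => x) ν) (w : ι → ℝ) :
    Integrable (fun x => w ⬝ᵥ x) ν :=
  integrable_finsetSum _ fun i _ => (hν.eval i).const_mul (w i)

lemma lintegral_exp_dotProduct_eq_tilted [NeZero ρ]
    (hint : Integrable (fun x => exp (θ₀ ⬝ᵥ x)) ρ) (θ : ι → ℝ) :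
    ∫⁻ x, ENNReal.ofReal (exp (θ ⬝ᵥ x)) ∂ρ =
      ENNReal.ofReal (∫ x, exp (θ₀ ⬝ᵥ x) ∂ρ) *
        ∫⁻ x, ENNReal.ofReal (exp ((θ - θ₀) ⬝ᵥ x)) ∂(ρ.tilted fun x => θ₀ ⬝ᵥ x) := by
  have hZ : 0 < ∫ x, exp (θ₀ ⬝ᵥ x) ∂ρ := integral_exp_pos hint
  rw [lintegral_tilted, ← lintegral_const_mul _ (by fun_prop)]
  refine lintegral_congr fun x => ?_
  rw [← ENNReal.ofReal_mul (by positivity), ← ENNReal.ofReal_mul hZ.le, sub_dotProduct, exp_sub]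
  congr 1
  field_simp

/-- The mean of the Gibbs measure is a subgradient of the log-Laplace transform. -/
lemma ofReal_mul_exp_le_lintegral_exp [NeZero ρ]
    (hθ₀ : ∀ᶠ θ in 𝓝 θ₀, Integrable (fun x => exp (θ ⬝ᵥ x)) ρ) (θ : ι → ℝ) :
    ENNReal.ofReal ((∫ x, exp (θ₀ ⬝ᵥ x) ∂ρ) *
        exp ((θ - θ₀) ⬝ᵥ ∫ x, x ∂(ρ.tilted fun x => θ₀ ⬝ᵥ x))) ≤
      ∫⁻ x, ENNReal.ofReal (exp (θ ⬝ᵥ x)) ∂ρ := by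
  have hint := hθ₀.self_of_nhds
  have := isProbabilityMeasure_tilted hint
  have hid := integrable_id_tilted hθ₀
  rw [lintegral_exp_dotProduct_eq_tilted hint, ENNReal.ofReal_mul (integral_exp_pos hint).le]
  gcongr
  by_cases hexp : Integrable (fun x => exp ((θ - θ₀) ⬝ᵥ x)) (ρ.tilted fun x => θ₀ ⬝ᵥ x)
  · rw [← ofReal_integral_eq_lintegral_ofReal hexp (ae_of_all _ fun x => (exp_pos _).le),
      ← integral_dotProduct hid]
    exact ENNReal.ofReal_le_ofReal (convexOn_exp.map_integral_le continuous_exp.continuousOn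
      isClosed_univ (by simp) (integrable_dotProduct hid _) hexp)
  · have htop : ∫⁻ x, ENNReal.ofReal (exp ((θ - θ₀) ⬝ᵥ x)) ∂(ρ.tilted fun x => θ₀ ⬝ᵥ x) = ⊤ := by
      by_contra hne
      exact hexp ((lintegral_ofReal_ne_top_iff_integrable (by fun_prop)
        (ae_of_all _ fun x => (exp_pos _).le)).1 hne)
    rw [htop]
    exact le_top

/-- The mean of the Gibbs measure is the only subgradient of the log-Laplace transform. -/
lemma exists_lintegral_exp_lt_ofReal_mul_exp [NeZero ρ]
    (hθ₀ : ∀ᶠ θ in 𝓝 θ₀, Integrable (fun x => exp (θ ⬝ᵥ x)) ρ) {y : ι → ℝ}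
    (hy : y ≠ ∫ x, x ∂(ρ.tilted fun x => θ₀ ⬝ᵥ x)) :
    ∃ θ, ∫⁻ x, ENNReal.ofReal (exp (θ ⬝ᵥ x)) ∂ρ <
      ENNReal.ofReal ((∫ x, exp (θ₀ ⬝ᵥ x) ∂ρ) * exp ((θ - θ₀) ⬝ᵥ y)) := by
  have hint := hθ₀.self_of_nhds
  have := isProbabilityMeasure_tilted hint
  set ν := ρ.tilted fun x => θ₀ ⬝ᵥ x with hν
  set w := y - ∫ x, x ∂ν with hw
  have hmem : 0 ∈ interior (integrableExpSet (fun x => w ⬝ᵥ x) ν) :=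
    zero_mem_interior_integrableExpSet_tilted hθ₀ w
  have hgap : ∫ x, w ⬝ᵥ x ∂ν < w ⬝ᵥ y := by
    have hpos : 0 < w ⬝ᵥ w :=
      lt_of_le_of_ne (Finset.sum_nonneg fun i _ => mul_self_nonneg (w i))
        fun h0 => sub_ne_zero.2 hy (dotProduct_self_eq_zero.1 h0.symm)
    rw [integral_dotProduct (integrable_id_tilted hθ₀), ← sub_pos, ← dotProduct_sub]
    exact hpos
  have hderiv : HasDerivAt (fun t => exp (t * (w ⬝ᵥ y)) - mgf (fun x => w ⬝ᵥ x) ν t)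
      (w ⬝ᵥ y - ∫ x, w ⬝ᵥ x ∂ν) 0 := by
    have h₁ : HasDerivAt (fun t : ℝ => exp (t * (w ⬝ᵥ y))) (w ⬝ᵥ y) 0 := by
      simpa using ((hasDerivAt_id (0 : ℝ)).mul_const (w ⬝ᵥ y)).exp
    have h₂ := hasDerivAt_mgf hmem
    simp only [zero_mul, exp_zero, mul_one] at h₂
    exact h₁.sub h₂
  have hpos : ∀ᶠ t in 𝓝[>] (0 : ℝ), mgf (fun x => w ⬝ᵥ x) ν t < exp (t * (w ⬝ᵥ y)) := by
    have hslope := (hasDerivAt_iff_tendsto_slope.1 hderiv).mono_left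
      (nhdsWithin_mono 0 fun t (ht : 0 < t) => ht.ne')
    filter_upwards [hslope.eventually_const_lt (sub_pos.2 hgap), self_mem_nhdsWithin]
      with t ht ht0
    rw [slope_def_field, lt_div_iff₀ (by simpa using ht0)] at ht
    simpa using ht
  obtain ⟨t, ht, htint⟩ := (hpos.and
    (nhdsWithin_le_nhds (mem_interior_iff_mem_nhds.1 hmem))).exists
  refine ⟨θ₀ + t • w, ?_⟩
  have hZ : 0 < ∫ x, exp (θ₀ ⬝ᵥ x) ∂ρ := integral_exp_pos hint
  rw [lintegral_exp_dotProduct_eq_tilted hint, ENNReal.ofReal_mul hZ.le, add_sub_cancel_left]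
  simp only [smul_dotProduct, smul_eq_mul]
  rw [← hν, ← ofReal_integral_eq_lintegral_ofReal htint (ae_of_all _ fun x => (exp_pos _).le)]
  exact ENNReal.mul_lt_mul_right (by simpa using hZ) ENNReal.ofReal_ne_top
    ((ENNReal.ofReal_lt_ofReal_iff (exp_pos _)).2 ht)

/-- The mean of the Gibbs measure of a convex set lies in the interior of that set. -/
lemma integral_tilted_mem_interior {P : Set (ι → ℝ)} (hP : Convex ℝ P) (hPm : MeasurableSet P)
    (hPint : (interior P).Nonempty)
    (hθ₀ : ∀ᶠ θ in 𝓝 θ₀, Integrable (fun x => exp (θ ⬝ᵥ x)) (volume.restrict P)) :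
    ∫ x, x ∂((volume.restrict P).tilted fun x => θ₀ ⬝ᵥ x) ∈ interior P := by
  obtain ⟨p, hp⟩ := hPint
  obtain ⟨r, hr, hball⟩ := Metric.nhds_basis_closedBall.mem_iff.1 (isOpen_interior.mem_nhds hp)
  have hint := hθ₀.self_of_nhds
  have hid := integrable_id_tilted hθ₀
  have hvol : volume.restrict P (Metric.closedBall p r) ≠ 0 := by
    rw [Measure.restrict_apply Metric.isClosed_closedBall.measurableSet,
      Set.inter_eq_left.2 (hball.trans interior_subset)]
    exact (Metric.measure_closedBall_pos volume p hr).ne'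
  have : NeZero (volume.restrict P) := ⟨fun h => hvol (by simp [h])⟩
  have := isProbabilityMeasure_tilted hint
  have hball0 : (volume.restrict P).tilted (fun x => θ₀ ⬝ᵥ x) (Metric.closedBall p r) ≠ 0 :=
    fun h => hvol (absolutelyContinuous_tilted hint h)
  rw [← average_eq_integral]
  refine hP.average_mem_interior_of_set hball0
    ((tilted_absolutelyContinuous _ _).ae_le (ae_restrict_mem hPm)) hid (hball ?_)
  exact (convex_closedBall p r).set_average_mem Metric.isClosed_closedBall hball0
    (measure_ne_top _ _) (ae_restrict_mem Metric.isClosed_closedBall.measurableSet)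
    hid.integrableOn

end GibbsMeasure

/-- The point of the entropic central path with parameter `μ` is the unique minimizer of
`x ↦ ⟨c,x⟩ + μ f*_P(x)` over the interior of `P`, and it is given by the Gibbs mean
`(∫_P e^{-⟨c,x⟩/μ} dx)⁻¹ ∫_P e^{-⟨c,x⟩/μ} x dx`. -/
theorem entropic_central_path_eq_gibbs_mean
    (n m : ℕ) (A : Matrix (Fin m) (Fin n) ℝ) (b : Fin m → ℝ)
    (P : Set (Fin n → ℝ)) (hP : P = {x | ∀ i, ∑ j, A i j * x j ≤ b i})
    (hPint : (interior P).Nonempty)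
    (c : Fin n → ℝ) (μ : ℝ) (hμ : 0 < μ)
    -- the recession cone of `P`
    (recP : Set (Fin n → ℝ))
    (hrecP : recP = {z | ∃ x ∈ P, ∀ t : ℝ, 0 ≤ t → x + t • z ∈ P})
    -- `-c` lies in the interior of the polar cone of the recession cone of `P`
    (hc : -c ∈ interior {y : Fin n → ℝ | ∀ z ∈ recP, ∑ i, y i * z i ≤ 0})
    -- the logarithmic Laplace transform of the characteristic function of `P`,
    -- with value `+∞` when the integral diverges
    (fP : (Fin n → ℝ) → EReal)
    (hfP : fP = fun θ => ENNReal.log (∫⁻ x in P, ENNReal.ofReal (exp (∑ i, θ i * x i))))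
    -- the entropic barrier: the Fenchel conjugate of `fP`
    (fstar : (Fin n → ℝ) → EReal)
    (hfstar : fstar = fun x => ⨆ θ : Fin n → ℝ, (((∑ i, θ i * x i : ℝ) : EReal) - fP θ))
    -- the penalized objective function
    (g : (Fin n → ℝ) → EReal)
    (hg : g = fun x => ((∑ i, c i * x i : ℝ) : EReal) + (μ : EReal) * fstar x)
    -- the Gibbs mean
    (z : Fin n → ℝ)
    (hz : z = (∫ x in P, exp (-(∑ i, c i * x i) / μ))⁻¹ •
            ∫ x in P, exp (-(∑ i, c i * x i) / μ) • x) :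
    z ∈ interior P ∧ ∀ y ∈ interior P, y ≠ z → g z < g y := by
  have hPne : P.Nonempty := hPint.mono interior_subset
  have hPdot : P = {x | ∀ i, A i ⬝ᵥ x ≤ b i} := hP
  have hPclosed : IsClosed P := by
    rw [hPdot, Set.ofPred_forall]
    exact isClosed_iInter fun i => isClosed_le (by fun_prop) continuous_const
  have hPconv : Convex ℝ P := by
    rw [hPdot, Set.ofPred_forall]
    exact convex_iInter fun i =>
      convex_halfSpace_le ⟨dotProduct_add _, fun t x => dotProduct_smul t _ x⟩ _
  have hpolar : -c ∈ interior {y : Fin n → ℝ | ∀ u, (∀ i, A i ⬝ᵥ u ≤ 0) → y ⬝ᵥ u ≤ 0} := by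
    refine interior_mono ?_ hc
    intro y hy u hu
    refine hy u ?_
    obtain ⟨p, hp⟩ := hPne
    rw [hrecP]
    refine ⟨p, hp, fun t ht => ?_⟩
    rw [hPdot] at hp ⊢
    intro i
    rw [dotProduct_add, dotProduct_smul, smul_eq_mul]
    nlinarith [hp i, mul_nonneg ht (neg_nonneg.2 (hu i))]
  obtain ⟨a, ha, R, hR⟩ := exists_dotProduct_le_sub_norm A b hpolar
  set θ₀ : Fin n → ℝ := μ⁻¹ • -c with hθ₀_def
  have hcθ₀ : ∀ x, c ⬝ᵥ x = -(μ * (θ₀ ⬝ᵥ x)) := by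
    intro x
    rw [hθ₀_def, smul_dotProduct, neg_dotProduct, smul_eq_mul, mul_inv_cancel_left₀ hμ.ne', neg_neg]
  have hθ₀ : ∀ᶠ θ in 𝓝 θ₀, Integrable (fun x => exp (θ ⬝ᵥ x)) (volume.restrict P) := by
    refine eventually_integrable_exp_dotProduct hPclosed.measurableSet
      (a := μ⁻¹ * a) (R := μ⁻¹ * R) (by positivity) fun x hx => ?_
    rw [hPdot] at hx
    have h := mul_le_mul_of_nonneg_left (hR x hx) (inv_nonneg.2 hμ.le)
    rw [hθ₀_def, smul_dotProduct, smul_eq_mul]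
    linarith
  have hexponent : ∀ x : Fin n → ℝ, -(∑ i, c i * x i) / μ = θ₀ ⬝ᵥ x := by
    intro x
    rw [div_eq_iff hμ.ne']
    change -(c ⬝ᵥ x) = _
    rw [hcθ₀]
    ring
  have hz_mean : z = ∫ x, x ∂((volume.restrict P).tilted fun x => θ₀ ⬝ᵥ x) := by
    simp only [hz, hexponent, integral_tilted, div_eq_inv_mul, mul_smul]
    rw [integral_smul]
  have hvol : NeZero (volume.restrict P) := by
    refine ⟨fun h => (isOpen_interior.measure_pos volume hPint).ne' ?_⟩
    exact measure_mono_null interior_subset (Measure.restrict_eq_zero.1 h)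
  set Z := ∫ x in P, exp (θ₀ ⬝ᵥ x) with hZ_def
  have hZ : 0 < Z := integral_exp_pos hθ₀.self_of_nhds
  have hgz : g z ≤ ((-(μ * log Z) : ℝ) : EReal) := by
    have hstar : fstar z ≤ ((θ₀ ⬝ᵥ z - log Z : ℝ) : EReal) := by
      rw [hfstar]
      refine iSup_le fun θ => ?_
      have hlog := ENNReal.log_monotone (ofReal_mul_exp_le_lintegral_exp hθ₀ θ)
      rw [← hZ_def, ← hz_mean, ENNReal.log_ofReal_of_pos (by positivity),
        log_mul hZ.ne' (exp_pos _).ne', log_exp, sub_dotProduct] at hlog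
      rw [hfP]
      refine (EReal.sub_le_sub le_rfl hlog).trans ?_
      change ((θ ⬝ᵥ z : ℝ) : EReal) - _ ≤ _
      rw [← EReal.coe_sub, EReal.coe_le_coe_iff]
      linarith
    have hmul := mul_le_mul_of_nonneg_left hstar (EReal.coe_nonneg.2 hμ.le)
    rw [hg]
    refine (add_le_add le_rfl hmul).trans ?_
    change ((c ⬝ᵥ z : ℝ) : EReal) + _ ≤ _
    rw [← EReal.coe_mul, ← EReal.coe_add, EReal.coe_le_coe_iff, hcθ₀]
    linarith
  refine ⟨hz_mean ▸ integral_tilted_mem_interior hPconv hPclosed.measurableSet hPint hθ₀,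
    fun y _ hyz => hgz.trans_lt ?_⟩
  obtain ⟨θ, hθ⟩ := exists_lintegral_exp_lt_ofReal_mul_exp hθ₀ (hz_mean ▸ hyz)
  rw [← hZ_def] at hθ
  have hlog := ENNReal.log_strictMono hθ
  rw [ENNReal.log_ofReal_of_pos (by positivity), log_mul hZ.ne' (exp_pos _).ne', log_exp,
    sub_dotProduct] at hlog
  obtain ⟨s, hs, hs_lt⟩ := EReal.lt_iff_exists_real_btwn.1 hlog
  rw [EReal.coe_lt_coe_iff] at hs_lt
  have hstar : ((θ ⬝ᵥ y - s : ℝ) : EReal) ≤ fstar y := by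
    rw [hfstar, EReal.coe_sub]
    refine le_trans ?_ (le_iSup _ θ)
    rw [hfP]
    exact EReal.sub_le_sub le_rfl hs.le
  have hmul := mul_le_mul_of_nonneg_left hstar (EReal.coe_nonneg.2 hμ.le)
  rw [hg]
  refine lt_of_lt_of_le ?_ (add_le_add le_rfl hmul)
  change _ < ((c ⬝ᵥ y : ℝ) : EReal) + _
  rw [← EReal.coe_mul, ← EReal.coe_add, EReal.coe_lt_coe_iff, hcθ₀]
  nlinarith
end

section
/- Let P = {x ∈ ℝ^n : A x ≤ b} be a nonempty polyhedron. For θ ∈ ℝ^n, one has θ ∈ interior((rec P)°) if and only if the linear function x ↦ ⟨θ, x⟩ is bounded from above over P and the set of points of P maximizing this function is nonempty and compact. -/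
open Set Filter Topology

/-- A polyhedron whose recession cone is trivial is compact. -/
lemma isCompact_polyhedron_of_trivial_recession {ι κ : Type*} [Fintype ι] [Fintype κ]
    (a : ι → κ → ℝ) (ha : ∀ z : κ → ℝ, (∀ i, a i ⬝ᵥ z ≤ 0) → z = 0) (d : ι → ℝ) :
    IsCompact {x : κ → ℝ | ∀ i, a i ⬝ᵥ x ≤ d i} := by
  have hcont : ∀ i, Continuous fun x : κ → ℝ => a i ⬝ᵥ x := fun i =>
    continuous_const.dotProduct continuous_id
  refine Metric.isCompact_of_isClosed_isBounded ?_ ?_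
  · simp only [ofPred_forall]
    exact isClosed_iInter fun i => isClosed_le (hcont i) continuous_const
  let g : (κ → ℝ) → ℝ := fun x => ∑ i, max (a i ⬝ᵥ x) 0
  have hg : Continuous g :=
    continuous_finsetSum _ fun i _ => (hcont i).max continuous_const
  have hpos : ∀ z ∈ Metric.sphere (0 : κ → ℝ) 1, 0 < g z := by
    intro z hz
    have hz0 : z ≠ 0 := ne_zero_of_mem_unit_sphere ⟨z, hz⟩
    obtain ⟨i, hi⟩ : ∃ i, 0 < a i ⬝ᵥ z := by
      by_contra! h
      exact hz0 (ha z h)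
    exact Finset.sum_pos' (fun _ _ => le_max_right _ _)
      ⟨i, Finset.mem_univ i, lt_max_of_lt_left hi⟩
  obtain ⟨ε, hε, hgε⟩ : ∃ ε > 0, ∀ z ∈ Metric.sphere (0 : κ → ℝ) 1, ε ≤ g z :=
    (isCompact_sphere (0 : κ → ℝ) 1).exists_forall_le' hg.continuousOn hpos
  refine isBounded_iff_forall_norm_le.2 ⟨(∑ i, max (d i) 0) / ε, fun x hx => ?_⟩
  rw [le_div_iff₀ hε]
  have hgx : g x ≤ ∑ i, max (d i) 0 :=
    Finset.sum_le_sum fun i _ => max_le_max_right 0 (hx i)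
  refine le_trans ?_ hgx
  rcases eq_or_ne x 0 with rfl | hx0
  · simp [g]
  have hn : 0 < ‖x‖ := norm_pos_iff.2 hx0
  have hscale : g x = ‖x‖ * g (‖x‖⁻¹ • x) := by
    simp only [g, Finset.mul_sum]
    refine Finset.sum_congr rfl fun i _ => ?_
    rw [mul_max_of_nonneg _ _ hn.le, dotProduct_smul, smul_eq_mul, mul_inv_cancel_left₀ hn.ne',
      mul_zero]
  rw [hscale]
  refine mul_le_mul_of_nonneg_left (hgε _ ?_) hn.le
  simp [norm_smul, hx0]

/-- An affine function bounded above on the nonnegative half-line has nonpositive slope. -/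
lemma nonpos_of_forall_add_mul_le {r s c : ℝ} (h : ∀ t : ℝ, 0 ≤ t → r + t * s ≤ c) : s ≤ 0 := by
  by_contra! hs
  have h0 := h 0 le_rfl
  have h1 := h ((c - r + 1) / s) (div_nonneg (by linarith) hs.le)
  rw [div_mul_cancel₀ _ hs.ne'] at h1
  linarith

/-- The recession cone of a nonempty polyhedron `{x | Ax ≤ b}` is `{z | Az ≤ 0}`. -/
lemma mem_recession_polyhedron_iff {ι κ : Type*} [Fintype κ] (a : ι → κ → ℝ) (b : ι → ℝ)
    (hne : {x : κ → ℝ | ∀ i, a i ⬝ᵥ x ≤ b i}.Nonempty) (z : κ → ℝ) :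
    (∃ x ∈ {x : κ → ℝ | ∀ i, a i ⬝ᵥ x ≤ b i}, ∀ t : ℝ, 0 ≤ t →
      x + t • z ∈ {x : κ → ℝ | ∀ i, a i ⬝ᵥ x ≤ b i}) ↔ ∀ i, a i ⬝ᵥ z ≤ 0 := by
  simp only [mem_ofPred_eq, dotProduct_add, dotProduct_smul, smul_eq_mul]
  constructor
  · rintro ⟨x, -, h⟩ i
    exact nonpos_of_forall_add_mul_le fun t ht => h t ht i
  · intro h
    obtain ⟨x, hx⟩ := hne
    exact ⟨x, hx, fun t ht i => by linarith [hx i, mul_nonpos_of_nonneg_of_nonpos ht (h i)]⟩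

/-- A vector lies in the interior of the polar of a polyhedral cone exactly when it is negative on
the nonzero elements of the cone. -/
lemma mem_interior_polar_iff {ι κ : Type*} [Fintype κ] (a : ι → κ → ℝ) (θ : κ → ℝ) :
    θ ∈ interior {y : κ → ℝ | ∀ z, (∀ i, a i ⬝ᵥ z ≤ 0) → y ⬝ᵥ z ≤ 0} ↔
      ∀ z, (∀ i, a i ⬝ᵥ z ≤ 0) → z ≠ 0 → θ ⬝ᵥ z < 0 := by
  rw [mem_interior_iff_mem_nhds]
  constructor
  · intro h z hz hz0
    have hlim : Tendsto (fun t : ℝ => θ + t • z) (𝓝[>] 0) (𝓝 θ) := by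
      have : Continuous fun t : ℝ => θ + t • z := by fun_prop
      simpa using (this.tendsto 0).mono_left nhdsWithin_le_nhds
    obtain ⟨t, ht, htpos⟩ := ((hlim.eventually h).and self_mem_nhdsWithin).exists
    have h1 : (θ + t • z) ⬝ᵥ z ≤ 0 := ht z hz
    rw [add_dotProduct, smul_dotProduct, smul_eq_mul] at h1
    have hzz : 0 < z ⬝ᵥ z := by simpa using Matrix.dotProduct_star_self_pos_iff.2 hz0
    linarith [mul_pos htpos hzz]
  · intro h
    let K : Set (κ → ℝ) := Metric.sphere 0 1 ∩ {z | ∀ i, a i ⬝ᵥ z ≤ 0}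
    have hK : IsCompact K := by
      refine (isCompact_sphere _ _).inter_right ?_
      simp only [ofPred_forall]
      exact isClosed_iInter fun i =>
        isClosed_le (continuous_const.dotProduct continuous_id) continuous_const
    have hev : ∀ᶠ y in 𝓝 θ, ∀ z ∈ K, y ⬝ᵥ z < 0 := by
      refine hK.eventually_forall_of_forall_eventually fun z hz => ?_
      have hc : Continuous fun p : (κ → ℝ) × (κ → ℝ) => p.1 ⬝ᵥ p.2 :=
        continuous_fst.dotProduct continuous_snd
      exact hc.continuousAt.eventually_lt continuousAt_const
        (h z hz.2 (ne_zero_of_mem_unit_sphere ⟨z, hz.1⟩))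
    filter_upwards [hev] with y hy z hz
    rcases eq_or_ne z 0 with rfl | hz0
    · simp
    have hn : 0 < ‖z‖ := norm_pos_iff.2 hz0
    have hneg : y ⬝ᵥ (‖z‖⁻¹ • z) < 0 := by
      refine hy _ ⟨by simp [norm_smul, hn.ne'], fun i => ?_⟩
      rw [dotProduct_smul, smul_eq_mul]
      exact mul_nonpos_of_nonneg_of_nonpos (inv_nonneg.2 hn.le) (hz i)
    rw [dotProduct_smul, smul_eq_mul] at hneg
    exact (neg_of_mul_neg_right hneg (inv_nonneg.2 hn.le)).le

/-- If `θ` is negative on the nonzero recession directions of a polyhedron, the superlevel sets of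
`θ` on the polyhedron are compact. -/
lemma isCompact_superlevel_polyhedron {ι κ : Type*} [Fintype ι] [Fintype κ]
    (a : ι → κ → ℝ) (b : ι → ℝ) (θ : κ → ℝ)
    (h : ∀ z, (∀ i, a i ⬝ᵥ z ≤ 0) → z ≠ 0 → θ ⬝ᵥ z < 0) (c : ℝ) :
    IsCompact {x : κ → ℝ | (∀ i, a i ⬝ᵥ x ≤ b i) ∧ c ≤ θ ⬝ᵥ x} := by
  have hcomp := isCompact_polyhedron_of_trivial_recession
    (fun o : Option ι => o.elim (-θ) a) (fun z hz => ?_) (fun o => o.elim (-c) b)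
  · simpa [Option.forall, and_comm] using hcomp
  · simp only [Option.forall, Option.elim_none, Option.elim_some, neg_dotProduct] at hz
    by_contra hz0
    linarith [h z hz.2 hz0, hz.1]


/-- For a nonempty polyhedron `P = {x : Ax ≤ b}`, a vector `θ` lies in the interior of the
polar cone of the recession cone of `P` if and only if the linear function `x ↦ ⟨θ,x⟩` is
bounded from above over `P` and its set of maximizers over `P` is nonempty and compact. -/
theorem mem_interior_polar_recession_iff
    (n m : ℕ) (A : Matrix (Fin m) (Fin n) ℝ) (b : Fin m → ℝ)
    (P : Set (Fin n → ℝ)) (hP : P = {x | ∀ i, ∑ j, A i j * x j ≤ b i})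
    (hPne : P.Nonempty)
    -- the recession cone of `P`
    (recP : Set (Fin n → ℝ))
    (hrecP : recP = {z | ∃ x ∈ P, ∀ t : ℝ, 0 ≤ t → x + t • z ∈ P})
    (θ : Fin n → ℝ) :
    θ ∈ interior {y : Fin n → ℝ | ∀ z ∈ recP, ∑ i, y i * z i ≤ 0} ↔
      (∃ M : ℝ, ∀ x ∈ P, ∑ i, θ i * x i ≤ M) ∧
      ({x ∈ P | ∀ y ∈ P, ∑ i, θ i * y i ≤ ∑ i, θ i * x i}.Nonempty ∧
        IsCompact {x ∈ P | ∀ y ∈ P, ∑ i, θ i * y i ≤ ∑ i, θ i * x i}) := by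
  have hrec : ∀ z, z ∈ recP ↔ ∀ i, A i ⬝ᵥ z ≤ 0 := by
    subst hP hrecP
    exact mem_recession_polyhedron_iff A b hPne
  have hmemP : ∀ x, x ∈ P ↔ ∀ i, A i ⬝ᵥ x ≤ b i := by
    subst hP
    exact fun x => Iff.rfl
  simp only [hrec]
  refine (mem_interior_polar_iff A θ).trans ?_
  change _ ↔ (∃ M : ℝ, ∀ x ∈ P, θ ⬝ᵥ x ≤ M) ∧
    ({x ∈ P | ∀ y ∈ P, θ ⬝ᵥ y ≤ θ ⬝ᵥ x}.Nonempty ∧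
      IsCompact {x ∈ P | ∀ y ∈ P, θ ⬝ᵥ y ≤ θ ⬝ᵥ x})
  constructor
  · intro h
    have hcomp : ∀ c : ℝ, IsCompact {x | x ∈ P ∧ c ≤ θ ⬝ᵥ x} := by
      simpa only [hmemP] using isCompact_superlevel_polyhedron A b θ h
    obtain ⟨x₀, hx₀⟩ := hPne
    have hθ : Continuous fun x : Fin n → ℝ => θ ⬝ᵥ x :=
      continuous_const.dotProduct continuous_id
    obtain ⟨x, ⟨hxP, hx₀x⟩, hmax⟩ :=
      (hcomp (θ ⬝ᵥ x₀)).exists_isMaxOn ⟨x₀, hx₀, le_rfl⟩ hθ.continuousOn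
    have hx : ∀ y ∈ P, θ ⬝ᵥ y ≤ θ ⬝ᵥ x := fun y hy =>
      (le_total (θ ⬝ᵥ x₀) (θ ⬝ᵥ y)).elim (fun hle => hmax ⟨hy, hle⟩) fun hle => hle.trans hx₀x
    refine ⟨⟨_, hx⟩, ⟨x, hxP, hx⟩, ?_⟩
    convert hcomp (θ ⬝ᵥ x) using 1
    ext y
    exact and_congr_right fun _ => ⟨fun hy => hy x hxP, fun hy w hw => (hx w hw).trans hy⟩
  · rintro ⟨-, ⟨x, hxP, hx⟩, hcomp⟩ z hz hz0
    have hray : ∀ t : ℝ, 0 ≤ t → x + t • z ∈ P := fun t ht => (hmemP _).2 fun i => by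
      rw [dotProduct_add, dotProduct_smul, smul_eq_mul]
      linarith [(hmemP x).1 hxP i, mul_nonpos_of_nonneg_of_nonpos ht (hz i)]
    have hle : θ ⬝ᵥ z ≤ 0 := nonpos_of_forall_add_mul_le fun t ht => by
      simpa only [dotProduct_add, dotProduct_smul, smul_eq_mul] using hx _ (hray t ht)
    refine lt_of_le_of_ne hle fun heq => ?_
    obtain ⟨R, hR⟩ := isBounded_iff_forall_norm_le.1 hcomp.isBounded
    have hbound : ∀ t : ℝ, 0 ≤ t → -‖x‖ + t * ‖z‖ ≤ R := by
      intro t ht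
      have hmem := hR (x + t • z) ⟨hray t ht, fun y hy => by
        simpa [dotProduct_add, dotProduct_smul, heq] using hx y hy⟩
      have htri : ‖t • z‖ ≤ ‖x + t • z‖ + ‖x‖ := by
        simpa using norm_sub_le (x + t • z) x
      rw [norm_smul, Real.norm_of_nonneg ht] at htri
      linarith
    exact (norm_pos_iff.2 hz0).not_ge (nonpos_of_forall_add_mul_le hbound)
end

section
/- Let P ⊆ ℝ^n be a Lebesgue-measurable set of positive measure that is not contained in any affine hyperplane of ℝ^n, and let U ⊆ ℝ^n be an open convex set such that for every θ ∈ U the function x ↦ e^{⟨θ,x⟩} is Lebesgue-integrable on P. Then the function f(θ) := log ∫_P e^{⟨θ,x⟩} dx is strictly convex on U. -/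
open MeasureTheory Real

/-- A level set of a nonzero linear functional on a finite-dimensional real space is null. -/
lemma addHaar_setOf_linearMap_eq {E : Type*} [NormedAddCommGroup E] [NormedSpace ℝ E]
    [MeasurableSpace E] [BorelSpace E] [FiniteDimensional ℝ E] (μ : Measure E)
    [μ.IsAddHaarMeasure] {L : E →ₗ[ℝ] ℝ} (hL : L ≠ 0) (c : ℝ) :
    μ {x | L x = c} = 0 := by
  let S : AffineSubspace ℝ E := (AffineSubspace.mk' c ⊥).comap L.toAffineMap
  have hS : (S : Set E) = {x | L x = c} := by
    ext x
    simp [S, sub_eq_zero]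
  rw [← hS]
  refine Measure.addHaar_affineSubspace μ S fun htop => hL ?_
  have h : ∀ x, L x = c := fun x => by
    have hx : x ∈ (S : Set E) := by simp [htop]
    rwa [hS] at hx
  ext x
  rw [h x, ← h 0, map_zero, LinearMap.zero_apply]

/-- Strict log-convexity of the integral of an exponential: the case of strict inequality in
Hölder's inequality. -/
lemma log_integral_exp_add_lt {α : Type*} [MeasurableSpace α] {μ : Measure α} {u v : α → ℝ}
    (hu : Integrable (fun x => exp (u x)) μ) (hv : Integrable (fun x => exp (v x)) μ)
    (huv : ∀ c, ¬ ∀ᵐ x ∂μ, u x - v x = c) {a b : ℝ} (ha : 0 < a) (hb : 0 < b)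
    (hab : a + b = 1) :
    log (∫ x, exp (a * u x + b * v x) ∂μ) <
      a * log (∫ x, exp (u x) ∂μ) + b * log (∫ x, exp (v x) ∂μ) := by
  have : NeZero μ := ⟨fun h => huv 0 (by simp [h])⟩
  have hA := integral_exp_pos hu
  have hB := integral_exp_pos hv
  set A := ∫ x, exp (u x) ∂μ with hAdef
  set B := ∫ x, exp (v x) ∂μ with hBdef
  have hum : AEMeasurable u μ := aemeasurable_of_aemeasurable_exp hu.aemeasurable
  have hvm : AEMeasurable v μ := aemeasurable_of_aemeasurable_exp hv.aemeasurable
  let g : α → ℝ := fun x => exp (a * (u x - log A) + b * (v x - log B))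
  let h : α → ℝ := fun x => a * exp (u x - log A) + b * exp (v x - log B)
  have hgh : ∀ x, g x ≤ h x := fun x =>
    convexOn_exp.2 (Set.mem_univ _) (Set.mem_univ _) ha.le hb.le hab
  have hlt : ∀ x, u x - v x ≠ log A - log B → g x < h x := fun x hx =>
    strictConvexOn_exp.2 (Set.mem_univ _) (Set.mem_univ _)
      (fun heq => hx (by linarith)) ha hb hab
  have hui : Integrable (fun x => a * exp (u x - log A)) μ := by
    simpa only [exp_sub] using (hu.div_const _).const_mul a
  have hvi : Integrable (fun x => b * exp (v x - log B)) μ := by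
    simpa only [exp_sub] using (hv.div_const _).const_mul b
  have hhi : Integrable h μ := hui.add hvi
  have hgi : Integrable g μ := by
    refine hhi.mono' (AEMeasurable.aestronglyMeasurable (by fun_prop)) (.of_forall fun x => ?_)
    rw [norm_of_nonneg (exp_pos _).le]
    exact hgh x
  have hint : ∫ x, g x ∂μ < ∫ x, h x ∂μ := by
    refine (integral_mono hgi hhi hgh).lt_of_ne fun heq => huv (log A - log B) ?_
    filter_upwards [(integral_eq_iff_of_ae_le hgi hhi (.of_forall hgh)).1 heq] with x hx
    by_contra hne
    exact (hlt x hne).ne hx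
  have hh : ∫ x, h x ∂μ = 1 := by
    rw [integral_add hui hvi]
    simp only [exp_sub, exp_log hA, exp_log hB, integral_const_mul, integral_div]
    rw [← hAdef, ← hBdef, div_self hA.ne', div_self hB.ne', mul_one, mul_one, hab]
  have hg : ∀ x, exp (a * u x + b * v x) = exp (a * log A + b * log B) * g x := fun x => by
    rw [← exp_add]
    ring_nf
  have hgpos : 0 < ∫ x, g x ∂μ := integral_exp_pos hgi
  simp only [hg, integral_const_mul]
  rw [log_mul (exp_pos _).ne' hgpos.ne', log_exp]
  linarith [log_neg hgpos (hh ▸ hint)]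

/-- If `P` has positive Lebesgue measure and is not contained in any affine hyperplane,
then the log-Laplace transform `f(θ) = log ∫_P e^{⟨θ,x⟩} dx` is strictly convex on any
open convex set `U` on which the defining integrals are finite. -/
theorem log_laplace_strictConvexOn
    (n : ℕ) (P : Set (Fin n → ℝ))
    (hPmeas : MeasurableSet P) (hPpos : 0 < volume P)
    (hPhyp : ¬ ∃ (v : Fin n → ℝ) (a : ℝ), v ≠ 0 ∧ ∀ x ∈ P, ∑ i, v i * x i = a)
    (U : Set (Fin n → ℝ)) (hUopen : IsOpen U) (hUconv : Convex ℝ U)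
    (hInt : ∀ θ ∈ U, IntegrableOn (fun x => exp (∑ i, θ i * x i)) P volume)
    (f : (Fin n → ℝ) → ℝ)
    (hf : f = fun θ => log (∫ x in P, exp (∑ i, θ i * x i))) :
    StrictConvexOn ℝ U f := by
  subst hf
  refine ⟨hUconv, fun θ₁ h₁ θ₂ h₂ hne a b ha hb hab => ?_⟩
  let L : (Fin n → ℝ) →ₗ[ℝ] ℝ := Fintype.linearCombination ℝ (θ₁ - θ₂)
  have hLx : ∀ x, L x = ∑ i, θ₁ i * x i - ∑ i, θ₂ i * x i := fun x => by
    simp only [L, Fintype.linearCombination_apply, ← Finset.sum_sub_distrib, Pi.sub_apply,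
      smul_eq_mul]
    exact Finset.sum_congr rfl fun i _ => by ring
  have hL : L ≠ 0 := fun h0 => hne <| funext fun i => by
    have := hLx (Pi.single i 1)
    simp [h0, Pi.single_apply] at this
    linarith
  have hnull : ∀ c, ¬ ∀ᵐ x ∂volume.restrict P,
      ∑ i, θ₁ i * x i - ∑ i, θ₂ i * x i = c := fun c hc => by
    rw [ae_restrict_iff' hPmeas] at hc
    have hlevel := addHaar_setOf_linearMap_eq volume hL c
    refine hPpos.ne' (measure_mono_null (fun x hx => ?_) (measure_union_null hlevel hc))
    by_cases hxc : L x = c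
    · exact Or.inl hxc
    · exact Or.inr fun h => hxc (hLx x ▸ h hx)
  have hcomb : ∀ x : Fin n → ℝ, ∑ i, (a • θ₁ + b • θ₂) i * x i =
      a * ∑ i, θ₁ i * x i + b * ∑ i, θ₂ i * x i := fun x => by
    simp only [Finset.mul_sum, ← Finset.sum_add_distrib, Pi.add_apply, Pi.smul_apply, smul_eq_mul]
    exact Finset.sum_congr rfl fun i _ => by ring
  simp only [hcomb, smul_eq_mul]
  exact log_integral_exp_add_lt (hInt θ₁ h₁) (hInt θ₂ h₂) hnull ha hb hab
end

section
/- Let K ⊆ ℝ^n be a convex body, i.e., a compact convex set with nonempty interior. Define f_K(θ) := log ∫_K e^{⟨θ,x⟩} dx and the entropic barrier f*_K(x) := sup_{θ ∈ ℝ^n} (⟨θ,x⟩ − f_K(θ)). Then f*_K(x) < +∞ if and only if x belongs to the interior of K. -/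
open MeasureTheory Real

section EntropicBarrier

open Filter Topology

variable {n : ℕ} {K : Set (Fin n → ℝ)}

lemma integrableOn_exp_sum_mul_sub (hK : IsCompact K) (θ x : Fin n → ℝ) :
    IntegrableOn (fun y => exp (∑ i, θ i * (y i - x i))) K :=
  ContinuousOn.integrableOn_compact hK (by fun_prop)

lemma integral_exp_sum_mul_sub_pos (hK : IsCompact K) (hKint : (interior K).Nonempty)
    (θ x : Fin n → ℝ) : 0 < ∫ y in K, exp (∑ i, θ i * (y i - x i)) := by
  have : NeZero (volume.restrict K) := ⟨by
    rw [Ne, Measure.restrict_eq_zero]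
    exact (Measure.measure_pos_of_nonempty_interior volume hKint).ne'⟩
  exact integral_exp_pos (integrableOn_exp_sum_mul_sub hK θ x)

lemma sum_mul_sub_log_integral_exp (hK : IsCompact K) (hKint : (interior K).Nonempty)
    (θ x : Fin n → ℝ) :
    ∑ i, θ i * x i - log (∫ y in K, exp (∑ i, θ i * y i)) =
      -log (∫ y in K, exp (∑ i, θ i * (y i - x i))) := by
  have h : ∫ y in K, exp (∑ i, θ i * y i) =
      exp (∑ i, θ i * x i) * ∫ y in K, exp (∑ i, θ i * (y i - x i)) := by
    rw [← integral_const_mul]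
    congr 1 with y
    rw [← exp_add, ← Finset.sum_add_distrib]
    congr 2 with i
    ring
  rw [h, log_mul (exp_pos _).ne' (integral_exp_sum_mul_sub_pos hK hKint θ x).ne', log_exp]
  ring

/-- The linear part of `1 + ⟨θ, y - x⟩ ≤ exp ⟨θ, y - x⟩` integrates to zero over a ball
centred at `x`. -/
lemma volume_closedBall_le_integral_exp (θ x : Fin n → ℝ) (r : ℝ) :
    volume.real (Metric.closedBall x r) ≤
      ∫ y in Metric.closedBall x r, exp (∑ i, θ i * (y i - x i)) := by
  set B := Metric.closedBall x r
  have hB : IsCompact B := isCompact_closedBall x r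
  have hodd : ∫ y in B, ∑ i, θ i * (y i - x i) = 0 := by
    have h := integral_sub_left_eq_self
      (B.indicator fun y => ∑ i, θ i * (y i - x i)) volume (x + x)
    have hneg : (fun y => B.indicator (fun y => ∑ i, θ i * (y i - x i)) (x + x - y)) =
        fun y => -B.indicator (fun y => ∑ i, θ i * (y i - x i)) y := by
      ext y
      have hmem : x + x - y ∈ B ↔ y ∈ B := by
        simp only [B, Metric.mem_closedBall, dist_eq_norm]
        rw [← norm_neg (y - x)]
        congr! 2
        abel
      by_cases hy : y ∈ B
      · rw [Set.indicator_of_mem (hmem.2 hy), Set.indicator_of_mem hy, ← Finset.sum_neg_distrib]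
        congr 1 with i
        simp only [Pi.sub_apply, Pi.add_apply]
        ring
      · rw [Set.indicator_of_notMem (mt hmem.1 hy), Set.indicator_of_notMem hy, neg_zero]
    rw [hneg, integral_neg, integral_indicator hB.measurableSet] at h
    linarith
  have hlin : IntegrableOn (fun y : Fin n → ℝ => ∑ i, θ i * (y i - x i)) B :=
    ContinuousOn.integrableOn_compact hB (by fun_prop)
  have hone : IntegrableOn (fun _ : Fin n → ℝ => (1 : ℝ)) B :=
    ContinuousOn.integrableOn_compact hB (by fun_prop)
  calc volume.real B = ∫ y in B, (1 + ∑ i, θ i * (y i - x i)) := by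
        rw [integral_add hone hlin, hodd]
        simp
    _ ≤ ∫ y in B, exp (∑ i, θ i * (y i - x i)) := by
        refine integral_mono (hone.add hlin) (integrableOn_exp_sum_mul_sub hB θ x) fun y => ?_
        simpa [add_comm] using add_one_le_exp (∑ i, θ i * (y i - x i))

lemma exists_forall_sum_mul_sub_neg (hK : Convex ℝ K) {x : Fin n → ℝ} (hx : x ∉ interior K) :
    ∃ θ : Fin n → ℝ, ∀ y ∈ interior K, ∑ i, θ i * (y i - x i) < 0 := by
  obtain ⟨f, hf⟩ := geometric_hahn_banach_open_point hK.interior isOpen_interior hx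
  refine ⟨fun i => f (Pi.single i 1), fun y hy => ?_⟩
  have h : ∑ i, f (Pi.single i 1) * (y i - x i) = f (y - x) := by
    rw [← ContinuousLinearMap.coe_coe, LinearMap.pi_apply_eq_sum_univ f.toLinearMap (y - x)]
    refine Finset.sum_congr rfl fun i _ => ?_
    simp only [ContinuousLinearMap.coe_coe, smul_eq_mul, Pi.sub_apply, mul_comm]
    congr 2
    ext j
    simp [Pi.single_apply, eq_comm]
  rw [h, map_sub]
  linarith [hf y hy]

lemma tendsto_integral_exp_nat_mul_zero (hK : IsCompact K) (hKconv : Convex ℝ K)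
    {θ x : Fin n → ℝ} (hθ : ∀ y ∈ interior K, ∑ i, θ i * (y i - x i) < 0) :
    Tendsto (fun k : ℕ => ∫ y in K, exp (∑ i, ((k : ℝ) • θ) i * (y i - x i))) atTop (𝓝 0) := by
  have hsum (k : ℕ) (y : Fin n → ℝ) :
      ∑ i, ((k : ℝ) • θ) i * (y i - x i) = k * ∑ i, θ i * (y i - x i) := by
    simp [Finset.mul_sum, mul_assoc]
  have hae : ∀ᵐ y ∂volume.restrict K, ∑ i, θ i * (y i - x i) < 0 := by
    rw [ae_restrict_iff' hK.measurableSet]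
    have h0 : ∀ᵐ y, y ∉ frontier K :=
      measure_eq_zero_iff_ae_notMem.1 (hKconv.addHaar_frontier volume)
    filter_upwards [h0] with y hy hyK
    exact hθ y (by_contra fun h => hy ⟨subset_closure hyK, h⟩)
  simp only [hsum]
  rw [← integral_zero (Fin n → ℝ) ℝ (μ := volume.restrict K)]
  refine tendsto_integral_of_dominated_convergence (fun _ => 1)
    (fun k => Continuous.aestronglyMeasurable (by fun_prop))
    (ContinuousOn.integrableOn_compact hK (by fun_prop)) (fun k => ?_) ?_
  · filter_upwards [hae] with y hy
    rw [norm_eq_abs, abs_exp, exp_le_one_iff]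
    exact mul_nonpos_of_nonneg_of_nonpos k.cast_nonneg hy.le
  · filter_upwards [hae] with y hy
    exact tendsto_exp_atBot.comp (tendsto_natCast_atTop_atTop.atTop_mul_const_of_neg hy)

end EntropicBarrier

/-- For a convex body `K ⊆ ℝ^n`, the entropic barrier `f*_K`, i.e. the Fenchel conjugate
of the log-Laplace transform `f_K(θ) = log ∫_K e^{⟨θ,x⟩} dx`, is finite at `x` if and
only if `x` lies in the interior of `K`. -/
theorem entropic_barrier_finite_iff_mem_interior
    (n : ℕ) (K : Set (Fin n → ℝ))
    (hKcomp : IsCompact K) (hKconv : Convex ℝ K) (hKint : (interior K).Nonempty)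
    (fK : (Fin n → ℝ) → ℝ)
    (hfK : fK = fun θ => log (∫ x in K, exp (∑ i, θ i * x i)))
    (fstar : (Fin n → ℝ) → EReal)
    (hfstar : fstar = fun x => ⨆ θ : Fin n → ℝ, ((∑ i, θ i * x i - fK θ : ℝ) : EReal))
    (x : Fin n → ℝ) :
    fstar x < ⊤ ↔ x ∈ interior K := by
  subst hfK hfstar
  simp only [sum_mul_sub_log_integral_exp hKcomp hKint]
  constructor
  · intro h
    by_contra hx
    obtain ⟨θ, hθ⟩ := exists_forall_sum_mul_sub_neg hKconv hx
    obtain ⟨M, hM, -⟩ := EReal.lt_iff_exists_real_btwn.1 h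
    have hbound (k : ℕ) :
        exp (-M) ≤ ∫ y in K, exp (∑ i, ((k : ℝ) • θ) i * (y i - x i)) := by
      rw [← le_log_iff_exp_le (integral_exp_sum_mul_sub_pos hKcomp hKint _ x)]
      have hle := EReal.coe_le_coe_iff.1 ((le_iSup
        (fun θ : Fin n → ℝ => ((-log (∫ y in K, exp (∑ i, θ i * (y i - x i))) : ℝ) : EReal))
        ((k : ℝ) • θ)).trans hM.le)
      linarith
    exact (exp_pos (-M)).not_ge
      (ge_of_tendsto' (tendsto_integral_exp_nat_mul_zero hKcomp hKconv hθ) hbound)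
  · intro hx
    obtain ⟨r, hr, hrK⟩ := Metric.nhds_basis_closedBall.mem_iff.1 (mem_interior_iff_mem_nhds.1 hx)
    have hpos : 0 < volume.real (Metric.closedBall x r) :=
      ENNReal.toReal_pos (Metric.measure_closedBall_pos volume x hr).ne'
        measure_closedBall_lt_top.ne
    refine (iSup_le fun θ => EReal.coe_le_coe_iff.2 (neg_le_neg (log_le_log hpos ?_))).trans_lt
      (EReal.coe_lt_top (-log (volume.real (Metric.closedBall x r))))
    exact (volume_closedBall_le_integral_exp θ x r).trans
      (setIntegral_mono_set (integrableOn_exp_sum_mul_sub hKcomp θ x)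
        (ae_of_all _ fun y => (exp_pos _).le) hrK.eventuallyLE)
end

section
/- Let n ≥ 1, let c ∈ ℝ^n with c_i > 0 for all i, let z ≥ 0, and let j ∈ {1,…,n}. Then ∫_{{x ∈ ℝ^n : x ≥ 0 entrywise, ⟨c,x⟩ ≥ z}} x_j e^{−⟨c,x⟩} dx = Γ(n+1, z) / (n! · c_j · c_1 ⋯ c_n), where Γ(n+1, z) := ∫_z^∞ u^{n} e^{−u} du is the upper incomplete Gamma function. -/
open MeasureTheory Real

open scoped ENNReal

/-- Convolving `uᵐ / m!` on the half-line with the indicator of the half-line raises the degree. -/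
lemma lintegral_lintegral_pow_div_factorial_mul_comp_add (m : ℕ) {f : ℝ → ℝ≥0∞}
    (hf : Measurable f) :
    ∫⁻ a in Set.Ici 0, ∫⁻ u in Set.Ici 0, ENNReal.ofReal (u ^ m / m.factorial) * f (a + u) =
      ∫⁻ v in Set.Ici 0, ENNReal.ofReal (v ^ (m + 1) / (m + 1).factorial) * f v := by
  have shift (u : ℝ) : ∫⁻ a in Set.Ici 0, f (a + u) = ∫⁻ v, (Set.Ici u).indicator f v := by
    rw [← lintegral_indicator measurableSet_Ici,
      ← lintegral_add_right_eq_self (fun v ↦ (Set.Ici u).indicator f v) u]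
    refine lintegral_congr fun a ↦ ?_
    simp [Set.indicator_apply]
  have primitive (v : ℝ) (hv : 0 ≤ v) :
      ∫⁻ u in Set.Icc 0 v, ENNReal.ofReal (u ^ m / m.factorial) =
        ENNReal.ofReal (v ^ (m + 1) / (m + 1).factorial) := by
    rw [← ofReal_integral_eq_lintegral_ofReal, integral_Icc_eq_integral_Ioc,
      ← intervalIntegral.integral_of_le hv, intervalIntegral.integral_div, integral_pow]
    · congr 1
      rw [Nat.factorial_succ]
      push_cast
      simp [div_div]
    · exact (by fun_prop : Continuous fun u : ℝ ↦ u ^ m / m.factorial).integrableOn_Icc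
    · filter_upwards [ae_restrict_mem measurableSet_Icc] with u hu
      have := hu.1
      positivity
  rw [lintegral_lintegral_swap (by fun_prop)]
  calc
    _ = ∫⁻ u in Set.Ici 0, ∫⁻ v, ENNReal.ofReal (u ^ m / m.factorial) *
          (Set.Ici u).indicator f v := by
      refine lintegral_congr fun u ↦ ?_
      rw [lintegral_const_mul _ (by fun_prop), shift,
        lintegral_const_mul _ (hf.indicator measurableSet_Ici)]
    _ = ∫⁻ v, ∫⁻ u in Set.Ici 0, ENNReal.ofReal (u ^ m / m.factorial) *
          (Set.Ici u).indicator f v := by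
      refine lintegral_lintegral_swap (Measurable.aemeasurable ?_)
      have : Measurable fun p : ℝ × ℝ ↦ {q : ℝ × ℝ | q.1 ≤ q.2}.indicator (fun q ↦ f q.2) p :=
        (hf.comp measurable_snd).indicator (measurableSet_le measurable_fst measurable_snd)
      exact (by fun_prop : Measurable fun p : ℝ × ℝ ↦
        ENNReal.ofReal (p.1 ^ m / m.factorial)).mul this
    _ = _ := by
      rw [← lintegral_indicator (measurableSet_Ici (a := (0 : ℝ)))]
      refine lintegral_congr fun v ↦ ?_
      have (u : ℝ) : ENNReal.ofReal (u ^ m / m.factorial) * (Set.Ici u).indicator f v =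
          (Set.Iic v).indicator (fun u ↦ ENNReal.ofReal (u ^ m / m.factorial) * f v) u := by
        simp [Set.indicator_apply]
      simp_rw [this]
      rw [setLIntegral_indicator measurableSet_Iic, Set.inter_comm, Set.Ici_inter_Iic,
        lintegral_mul_const _ (by fun_prop)]
      by_cases hv : 0 ≤ v
      · simp [hv, primitive]
      · simp [hv]

/-- The sum of the coordinates pushes Lebesgue measure on the nonnegative orthant forward to
`uᵐ / m! du` on the half-line. -/
lemma lintegral_pi_Ici_comp_sum (m : ℕ) {f : ℝ → ℝ≥0∞} (hf : Measurable f) :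
    ∫⁻ y, f (∑ i, y i) ∂(Measure.pi fun _ : Fin (m + 1) ↦ volume.restrict (Set.Ici (0 : ℝ))) =
      ∫⁻ u in Set.Ici 0, ENNReal.ofReal (u ^ m / m.factorial) * f u := by
  induction m generalizing f with
  | zero =>
    rw [← (measurePreserving_funUnique (volume.restrict (Set.Ici (0 : ℝ)))
      (Fin 1)).lintegral_comp (by fun_prop)]
    simp [MeasurableEquiv.funUnique]
    rfl
  | succ m ih =>
    rw [← lintegral_lintegral_pow_div_factorial_mul_comp_add m hf]
    have key := (measurePreserving_piFinSuccAbove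
      (fun _ : Fin (m + 2) ↦ volume.restrict (Set.Ici (0 : ℝ))) 0).lintegral_comp
      (f := fun p ↦ f (p.1 + ∑ i, p.2 i)) (by fun_prop)
    rw [lintegral_prod _ (by fun_prop)] at key
    simp_rw [← fun a : ℝ ↦ ih (f := fun u ↦ f (a + u)) (by fun_prop)]
    rw [← key]
    refine lintegral_congr fun y ↦ ?_
    rw [Fin.sum_univ_succ]
    rfl

lemma card_mul_lintegral_pi_coord_mul_comp_sum {ι : Type*} [Fintype ι] (μ : Measure ℝ)
    [SigmaFinite μ] {f g : ℝ → ℝ≥0∞} (hf : Measurable f) (hg : Measurable g) (j : ι) :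
    Fintype.card ι * ∫⁻ y, g (y j) * f (∑ i, y i) ∂(Measure.pi fun _ : ι ↦ μ) =
      ∫⁻ y, (∑ i, g (y i)) * f (∑ i, y i) ∂(Measure.pi fun _ : ι ↦ μ) := by
  classical
  have symmetric (k : ι) : ∫⁻ y, g (y k) * f (∑ i, y i) ∂(Measure.pi fun _ : ι ↦ μ) =
      ∫⁻ y, g (y j) * f (∑ i, y i) ∂(Measure.pi fun _ : ι ↦ μ) := by
    have key := ((measurePreserving_piCongrLeft (fun _ : ι ↦ μ) (Equiv.swap j k)).symm
      _).lintegral_comp (f := fun y ↦ g (y j) * f (∑ i, y i)) (by fun_prop)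
    rw [← key]
    refine lintegral_congr fun y ↦ ?_
    have apply_eq (i : ι) : (MeasurableEquiv.piCongrLeft (fun _ : ι ↦ ℝ)
        (Equiv.swap j k)).symm y i = y (Equiv.swap j k i) := rfl
    simp_rw [apply_eq, Equiv.swap_apply_left, Equiv.sum_comp (Equiv.swap j k) y]
  simp_rw [Finset.sum_mul]
  rw [lintegral_finsetSum _ (by fun_prop)]
  simp [symmetric]

lemma lintegral_pi_comp_mul {ι : Type*} [Fintype ι] {c : ι → ℝ} (hc : ∀ i, 0 < c i)
    {F : (ι → ℝ) → ℝ≥0∞} (hF : Measurable F) :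
    ENNReal.ofReal (∏ i, c i) * ∫⁻ x : ι → ℝ, F (fun i ↦ c i * x i) = ∫⁻ y, F y := by
  classical
  have hpos : 0 < ∏ i, c i := Finset.prod_pos fun i _ ↦ hc i
  have h := Real.smul_map_diagonal_volume_pi (D := c) (by simpa using hpos.ne')
  rw [Matrix.det_diagonal, abs_of_pos hpos] at h
  conv_rhs => rw [← h]
  rw [lintegral_smul_measure, lintegral_map hF
    (LinearMap.continuous_on_pi _).measurable, smul_eq_mul]
  simp [show ∀ x, Matrix.mulVec (Matrix.diagonal c) x = fun i ↦ c i * x i from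
    fun x ↦ funext fun i ↦ Matrix.mulVec_diagonal c x i]

/-- `∫_{x ≥ 0, ⟨c,x⟩ ≥ z} x_j e^{-⟨c,x⟩} dx = Γ(n+1,z) / (n! · c_j · c₁ ⋯ cₙ)`, where
`Γ(n+1,z) = ∫_z^∞ uⁿ e^{-u} du` is the upper incomplete Gamma function. -/
theorem integral_coord_mul_exp_neg_inner_tail
    (n : ℕ) (hn : 1 ≤ n) (c : Fin n → ℝ) (hc : ∀ i, 0 < c i) (z : ℝ) (hz : 0 ≤ z)
    (j : Fin n) :
    ∫ x in {x : Fin n → ℝ | (∀ i, 0 ≤ x i) ∧ z ≤ ∑ i, c i * x i},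
        x j * exp (-∑ i, c i * x i) =
      (∫ u in Set.Ici z, u ^ n * exp (-u)) / (n.factorial * c j * ∏ i, c i) := by
  obtain ⟨m, rfl⟩ : ∃ m, n = m + 1 := ⟨n - 1, by omega⟩
  have hprod : 0 < ∏ i, c i := Finset.prod_pos fun i _ ↦ hc i
  let f : ℝ → ℝ≥0∞ := (Set.Ici z).indicator fun u ↦ ENNReal.ofReal (exp (-u))
  have hf : Measurable f := by
    have : Measurable fun u : ℝ ↦ ENNReal.ofReal (exp (-u)) := by fun_prop
    exact this.indicator measurableSet_Ici
  let O : Set (Fin (m + 1) → ℝ) := Set.univ.pi fun _ ↦ Set.Ici 0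
  have hO : MeasurableSet O := MeasurableSet.univ_pi fun _ ↦ measurableSet_Ici
  have hS : MeasurableSet {x : Fin (m + 1) → ℝ | (∀ i, 0 ≤ x i) ∧ z ≤ ∑ i, c i * x i} := by
    measurability
  set L := ∫⁻ x in {x : Fin (m + 1) → ℝ | (∀ i, 0 ≤ x i) ∧ z ≤ ∑ i, c i * x i},
    ENNReal.ofReal (x j * exp (-∑ i, c i * x i)) with hL
  set R := ∫⁻ u in Set.Ici z, ENNReal.ofReal (u ^ (m + 1) * exp (-u)) with hR
  have left_eq : ∫ x in {x : Fin (m + 1) → ℝ | (∀ i, 0 ≤ x i) ∧ z ≤ ∑ i, c i * x i},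
      x j * exp (-∑ i, c i * x i) = L.toReal := by
    refine integral_eq_lintegral_of_nonneg_ae ?_ (by fun_prop)
    filter_upwards [ae_restrict_mem hS] with x hx
    exact mul_nonneg (hx.1 j) (exp_pos _).le
  have right_eq : ∫ u in Set.Ici z, u ^ (m + 1) * exp (-u) = R.toReal := by
    refine integral_eq_lintegral_of_nonneg_ae ?_ (by fun_prop)
    filter_upwards [ae_restrict_mem measurableSet_Ici] with u hu
    exact mul_nonneg (pow_nonneg (hz.trans hu) _) (exp_pos _).le
  have scaled : ENNReal.ofReal (∏ i, c i) * (ENNReal.ofReal (c j) * L) =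
      ∫⁻ y in O, ENNReal.ofReal (y j) * f (∑ i, y i) := by
    have hF : Measurable fun y : Fin (m + 1) → ℝ ↦ ENNReal.ofReal (y j) * f (∑ i, y i) := by
      fun_prop
    rw [← lintegral_indicator hO, ← lintegral_pi_comp_mul hc (hF.indicator hO), hL,
      ← lintegral_const_mul _ (by fun_prop), ← lintegral_indicator hS]
    congr 1
    refine lintegral_congr fun x ↦ ?_
    have mem_iff : (fun i ↦ c i * x i) ∈ O ↔ ∀ i, 0 ≤ x i :=
      Set.mem_univ_pi.trans (forall_congr' fun i ↦ mul_nonneg_iff_of_pos_left (hc i))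
    classical
    simp only [Set.indicator_apply, mem_iff, f, Set.mem_Ici, Set.mem_ofPred_eq]
    by_cases hx : ∀ i, 0 ≤ x i
    · by_cases hzx : z ≤ ∑ i, c i * x i
      · simp [hx, hzx, ENNReal.ofReal_mul, (hc j).le, mul_assoc]
      · simp [hzx]
    · simp [hx]
  have orthant : volume.restrict O =
      Measure.pi fun _ : Fin (m + 1) ↦ volume.restrict (Set.Ici (0 : ℝ)) :=
    Measure.restrict_pi_pi _ _
  have summed : ((m + 1 : ℕ) : ℝ≥0∞) * ∫⁻ y in O, ENNReal.ofReal (y j) * f (∑ i, y i) =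
      ENNReal.ofReal (m.factorial : ℝ)⁻¹ * R := by
    have h := card_mul_lintegral_pi_coord_mul_comp_sum (volume.restrict (Set.Ici (0 : ℝ))) hf
      ENNReal.measurable_ofReal j
    rw [Fintype.card_fin] at h
    rw [orthant, h]
    calc
      _ = ∫⁻ y, ENNReal.ofReal (∑ i, y i) * f (∑ i, y i)
          ∂(Measure.pi fun _ : Fin (m + 1) ↦ volume.restrict (Set.Ici (0 : ℝ))) := by
        rw [← orthant]
        refine setLIntegral_congr_fun hO fun y hy ↦ ?_
        rw [ENNReal.ofReal_sum_of_nonneg fun i _ ↦ hy i (Set.mem_univ i)]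
      _ = ∫⁻ u in Set.Ici 0, ENNReal.ofReal (u ^ m / m.factorial) * (ENNReal.ofReal u * f u) :=
        lintegral_pi_Ici_comp_sum m (f := fun u ↦ ENNReal.ofReal u * f u) (by fun_prop)
      _ = _ := by
        rw [hR, ← lintegral_const_mul _ (by fun_prop), ← lintegral_indicator measurableSet_Ici,
          ← lintegral_indicator measurableSet_Ici]
        refine lintegral_congr fun u ↦ ?_
        by_cases hu : z ≤ u
        · have hu0 : 0 ≤ u := hz.trans hu
          simp only [Set.indicator_apply, Set.mem_Ici, hu, hu0, if_true, f]
          rw [← ENNReal.ofReal_mul hu0, ← ENNReal.ofReal_mul (by positivity),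
            ← ENNReal.ofReal_mul (by positivity)]
          congr 1
          ring
        · simp [Set.indicator_apply, f, hu]
  rw [← scaled] at summed
  have real_eq := congrArg ENNReal.toReal summed
  simp only [ENNReal.toReal_mul, ENNReal.toReal_natCast, ENNReal.toReal_ofReal hprod.le,
    ENNReal.toReal_ofReal (hc j).le,
    ENNReal.toReal_ofReal (inv_nonneg.2 (Nat.cast_nonneg (α := ℝ) m.factorial))] at real_eq
  have hfac : (m.factorial : ℝ) ≠ 0 := by positivity
  have hcj := hc j
  rw [left_eq, right_eq, eq_div_iff (by positivity), Nat.factorial_succ]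
  field_simp at real_eq
  push_cast at real_eq ⊢
  linarith
end

section
/- Let S ⊆ ℝ^n be a nonempty compact set that is tropically convex, i.e., for all x, y ∈ S and all real numbers λ, μ ≤ 0 with max(λ, μ) = 0, the entrywise maximum (λ𝟙 + x) ∨ (μ𝟙 + y) belongs to S (where 𝟙 is the all-ones vector and ∨ denotes entrywise maximum). Then the point x* ∈ ℝ^n defined by x*_i := sup_{x ∈ S} x_i belongs to S; in other words, S admits a greatest element for the entrywise partial order, called its tropical barycenter. -/
/-- A nonempty compact sup-closed set of real vectors has a greatest element. -/
theorem IsCompact.exists_isGreatest_of_supClosed {ι : Type*} [Fintype ι] {S : Set (ι → ℝ)}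
    (hS : IsCompact S) (hne : S.Nonempty) (hsup : SupClosed S) : ∃ z, IsGreatest S z := by
  obtain ⟨z, hz, hmax⟩ := hS.exists_isMaxOn hne
    (f := fun x : ι → ℝ => ∑ i, x i) (by fun_prop)
  refine ⟨z, hz, fun x hx i => ?_⟩
  by_contra! hlt
  have hle : ∑ j, (z ⊔ x) j ≤ ∑ j, z j := hmax (hsup hz hx)
  have hgt : ∑ j, z j < ∑ j, (z ⊔ x) j :=
    Finset.sum_lt_sum (fun j _ => le_sup_left) ⟨i, Finset.mem_univ i, lt_sup_of_lt_right hlt⟩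
  exact hgt.not_ge hle

/-- Every nonempty compact tropically convex subset of `ℝ^n` contains its entrywise
supremum, i.e. admits a greatest element for the entrywise partial order (its tropical
barycenter). -/
theorem tropical_barycenter_mem
    (n : ℕ) (S : Set (Fin n → ℝ)) (hSne : S.Nonempty) (hScomp : IsCompact S)
    (hStrop : ∀ x ∈ S, ∀ y ∈ S, ∀ l m : ℝ, l ≤ 0 → m ≤ 0 → max l m = 0 →
      (fun i => max (l + x i) (m + y i)) ∈ S)
    (xstar : Fin n → ℝ) (hxstar : xstar = fun i => sSup ((fun x : Fin n → ℝ => x i) '' S)) :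
    xstar ∈ S ∧ ∀ x ∈ S, ∀ i, x i ≤ xstar i := by
  have hsup : SupClosed S := fun x hx y hy => by
    have h := hStrop x hx y hy 0 0 le_rfl le_rfl (max_self 0)
    simp only [zero_add] at h
    exact h
  obtain ⟨z, hz, hle⟩ := hScomp.exists_isGreatest_of_supClosed hSne hsup
  have hxz : xstar = z := by
    rw [hxstar]
    funext i
    exact IsGreatest.csSup_eq
      ⟨Set.mem_image_of_mem _ hz, Set.forall_mem_image.2 fun x hx => hle hx i⟩
  rw [hxz]
  exact ⟨hz, fun x hx i => hle hx i⟩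
end

section
/- Let r ≥ 2 be an integer, and define functions f_1, …, f_{2r} : ℝ → ℝ by f_1(μ) = min(μ, 2), f_2(μ) = 1, and for 1 ≤ j ≤ r−1: f_{2j+1}(μ) = 1 + min(f_{2j−1}(μ), f_{2j}(μ)) and f_{2j+2}(μ) = (1 − 2^{−j}) + max(f_{2j−1}(μ), f_{2j}(μ)). Then for all 1 ≤ j ≤ r−1 and all integers 0 ≤ k ≤ 2^{j−1} − 1: f_{2j+1}(2k/2^{j−1}) = j + 2k/2^j, f_{2j+1}((2k+1)/2^{j−1}) = j + (2k+2)/2^j, f_{2j+1}(2(k+1)/2^{j−1}) = j + (2k+2)/2^j, f_{2j+2}(2k/2^{j−1}) = j + (2k+1)/2^j, f_{2j+2}((2k+1)/2^{j−1}) = j + (2k+1)/2^j, and f_{2j+2}(2(k+1)/2^{j−1}) = j + (2k+3)/2^j. -/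
/-- Closed form of the recursion on the interval of length `2 / 2 ^ j` starting at
`2 * k / 2 ^ j`: the odd function rises with slope one and is then constant, and the even
function is constant and then rises with slope one. -/
theorem tropical_central_path_closed_form
    (r : ℕ) (f : ℕ → ℝ → ℝ)
    (hf1 : ∀ μ : ℝ, f 1 μ = min μ 2)
    (hf2 : ∀ μ : ℝ, f 2 μ = 1)
    (hfodd : ∀ j : ℕ, 1 ≤ j → j ≤ r - 1 → ∀ μ : ℝ,
      f (2 * j + 1) μ = 1 + min (f (2 * j - 1) μ) (f (2 * j) μ))
    (hfeven : ∀ j : ℕ, 1 ≤ j → j ≤ r - 1 → ∀ μ : ℝ,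
      f (2 * j + 2) μ = (1 - 1 / 2 ^ j) + max (f (2 * j - 1) μ) (f (2 * j) μ))
    (j : ℕ) (hj : j + 1 ≤ r - 1) (k : ℕ) (hk : k < 2 ^ j) (s : ℝ) (hs₀ : 0 ≤ s)
    (hs : s ≤ 2 / 2 ^ j) :
    f (2 * j + 3) (2 * k / 2 ^ j + s) = j + 1 + k / 2 ^ j + min s (1 / 2 ^ j) ∧
    f (2 * j + 4) (2 * k / 2 ^ j + s) = j + 1 + k / 2 ^ j - 1 / 2 ^ (j + 1) +
      max s (1 / 2 ^ j) := by
  induction j generalizing k s with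
  | zero =>
    obtain rfl : k = 0 := by simpa using hk
    have hodd := hfodd 1 le_rfl hj s
    have heven := hfeven 1 le_rfl hj s
    norm_num [hf1, hf2] at hodd heven hs ⊢
    rw [hodd, heven, min_eq_left hs]
    exact ⟨rfl, by ring⟩
  | succ j ih =>
    have hodd := hfodd (j + 2) (by omega) hj
    have heven := hfeven (j + 2) (by omega) hj
    rw [show 2 * (j + 2) - 1 = 2 * j + 3 by omega] at hodd heven
    rw [show 2 * (j + 1) + 3 = 2 * (j + 2) + 1 by ring,
      show 2 * (j + 1) + 4 = 2 * (j + 2) + 2 by ring, hodd, heven,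
      show 2 * (j + 2) = 2 * j + 4 by ring]
    rw [pow_succ] at hk
    have hpos : (0 : ℝ) < 1 / 2 ^ j := by positivity
    have hs' : s ≤ 1 / 2 ^ j := by
      convert hs using 1
      field_simp
      ring
    have htwo : (2 : ℝ) / 2 ^ j = 2 * (1 / 2 ^ j) := by ring
    have hhalf : (1 : ℝ) / 2 ^ (j + 1) = 1 / 2 ^ j / 2 := by field_simp; ring
    have hquarter : (1 : ℝ) / 2 ^ (j + 2) = 1 / 2 ^ j / 4 := by field_simp; ring
    rcases Nat.even_or_odd' k with ⟨m, rfl | rfl⟩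
    · obtain ⟨h₁, h₂⟩ := ih (by omega) m (by omega) s hs₀ (by linarith)
      have hμ : 2 * ((2 * m : ℕ) : ℝ) / 2 ^ (j + 1) + s = 2 * m / 2 ^ j + s := by
        push_cast; field_simp; ring
      have hc : ((2 * m : ℕ) : ℝ) / 2 ^ (j + 1) = m / 2 ^ j := by
        push_cast; field_simp; ring
      rw [hμ, h₁, h₂, hc, hquarter, hhalf, min_eq_left hs', max_eq_right hs']
      push_cast
      constructor <;> grind
    · obtain ⟨h₁, h₂⟩ := ih (by omega) m (by omega) (s + 1 / 2 ^ j) (by linarith) (by linarith)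
      have hμ : 2 * ((2 * m + 1 : ℕ) : ℝ) / 2 ^ (j + 1) + s
          = 2 * m / 2 ^ j + (s + 1 / 2 ^ j) := by
        push_cast; field_simp; ring
      have hc : ((2 * m + 1 : ℕ) : ℝ) / 2 ^ (j + 1) = m / 2 ^ j + 1 / 2 ^ j / 2 := by
        push_cast; field_simp; ring
      rw [min_eq_right (by linarith)] at h₁
      rw [max_eq_left (by linarith)] at h₂
      rw [hμ, h₁, h₂, hc, hquarter, hhalf]
      push_cast
      constructor <;> grind

/-- Values of the tropical central path recursion at the breakpoints
`2k/2^{j-1}`, `(2k+1)/2^{j-1}`, `2(k+1)/2^{j-1}` (Table 1 of the paper). -/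
theorem tropical_central_path_values
    (r : ℕ) (hr : 2 ≤ r) (f : ℕ → ℝ → ℝ)
    (hf1 : ∀ μ : ℝ, f 1 μ = min μ 2)
    (hf2 : ∀ μ : ℝ, f 2 μ = 1)
    (hfodd : ∀ j : ℕ, 1 ≤ j → j ≤ r - 1 → ∀ μ : ℝ,
      f (2 * j + 1) μ = 1 + min (f (2 * j - 1) μ) (f (2 * j) μ))
    (hfeven : ∀ j : ℕ, 1 ≤ j → j ≤ r - 1 → ∀ μ : ℝ,
      f (2 * j + 2) μ = (1 - 1 / 2 ^ j) + max (f (2 * j - 1) μ) (f (2 * j) μ)) :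
    ∀ j : ℕ, 1 ≤ j → j ≤ r - 1 → ∀ k : ℕ, k ≤ 2 ^ (j - 1) - 1 →
      f (2 * j + 1) (2 * k / 2 ^ (j - 1)) = j + 2 * k / 2 ^ j ∧
      f (2 * j + 1) ((2 * k + 1) / 2 ^ (j - 1)) = j + (2 * k + 2) / 2 ^ j ∧
      f (2 * j + 1) (2 * (k + 1) / 2 ^ (j - 1)) = j + (2 * k + 2) / 2 ^ j ∧
      f (2 * j + 2) (2 * k / 2 ^ (j - 1)) = j + (2 * k + 1) / 2 ^ j ∧
      f (2 * j + 2) ((2 * k + 1) / 2 ^ (j - 1)) = j + (2 * k + 1) / 2 ^ j ∧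
      f (2 * j + 2) (2 * (k + 1) / 2 ^ (j - 1)) = j + (2 * k + 3) / 2 ^ j := by
  intro j hj hjr k hk
  obtain ⟨i, rfl⟩ : ∃ i, j = i + 1 := ⟨j - 1, by omega⟩
  simp only [Nat.add_sub_cancel] at hk ⊢
  have hk' : k < 2 ^ i := by
    have := Nat.two_pow_pos i
    omega
  have hform := tropical_central_path_closed_form r f hf1 hf2 hfodd hfeven i hjr k hk'
  have hpos : (0 : ℝ) < 1 / 2 ^ i := by positivity
  have htwo : (2 : ℝ) / 2 ^ i = 2 * (1 / 2 ^ i) := by ring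
  obtain ⟨hl₁, hl₂⟩ := hform 0 le_rfl (by linarith)
  obtain ⟨hm₁, hm₂⟩ := hform (1 / 2 ^ i) hpos.le (by linarith)
  obtain ⟨hr₁, hr₂⟩ := hform (2 / 2 ^ i) (by linarith) le_rfl
  rw [add_zero, min_eq_left hpos.le] at hl₁
  rw [add_zero, max_eq_right hpos.le] at hl₂
  rw [← add_div, min_self] at hm₁
  rw [← add_div, max_self] at hm₂
  rw [← add_div, min_eq_right (by linarith)] at hr₁
  rw [← add_div, max_eq_left (by linarith)] at hr₂
  rw [show 2 * (i + 1) + 1 = 2 * i + 3 by ring, show 2 * (i + 1) + 2 = 2 * i + 4 by ring,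
    show (2 : ℝ) * (k + 1) = 2 * k + 2 by ring, hl₁, hl₂, hm₁, hm₂, hr₁, hr₂]
  push_cast
  refine ⟨?_, ?_, ?_, ?_, ?_, ?_⟩ <;> field_simp <;> ring
end

section
/- Let r ≥ 2 be an integer, and define functions f_1, …, f_{2r} : ℝ → ℝ by f_1(μ) = min(μ, 2), f_2(μ) = 1, and for 1 ≤ j ≤ r−1: f_{2j+1}(μ) = 1 + min(f_{2j−1}(μ), f_{2j}(μ)) and f_{2j+2}(μ) = (1 − 2^{−j}) + max(f_{2j−1}(μ), f_{2j}(μ)). Then for every i ∈ {1, …, 2r} and every integer 0 ≤ k ≤ 2^{r−1} − 1, the restriction of f_i to the interval [k/2^{r−2}, (k+1)/2^{r−2}] is an affine function; in particular, the curve μ ↦ (f_1(μ), …, f_{2r}(μ)) restricted to [0, 2] consists of at most 2^{r−1} linear pieces. -/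
/-- One step of the recursion on half of an interval centred at `m`: if `u - v = s * (μ - m)` there
with `s = ±1` and `v` affine, then the successor pair satisfies the same with sign `-t` and centre
`m + t * h`, where `t = ±1` selects the half on which `t * (μ - m) ≥ 0`. -/
lemma exists_affine_min_max_of_half {S : Set ℝ} {u v u' v' : ℝ → ℝ} {h m a b s t : ℝ}
    (hs : s = 1 ∨ s = -1) (ht : t = 1 ∨ t = -1) (hS : ∀ μ ∈ S, 0 ≤ t * (μ - m))
    (hv : ∀ μ ∈ S, v μ = a * μ + b) (hu : ∀ μ ∈ S, u μ = a * μ + b + s * (μ - m))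
    (hu' : ∀ μ, u' μ = 1 + min (u μ) (v μ)) (hv' : ∀ μ, v' μ = (1 - h) + max (u μ) (v μ)) :
    ∃ a' b' : ℝ, ∀ μ ∈ S, v' μ = a' * μ + b' ∧
      u' μ = a' * μ + b' + (-t) * (μ - (m + t * h)) := by
  have hcases : s = t ∨ s = -t := by
    rcases hs with rfl | rfl <;> rcases ht with rfl | rfl <;> norm_num
  have htt : t * t = 1 := by rcases ht with rfl | rfl <;> norm_num
  rcases hcases with rfl | rfl
  · refine ⟨a + s, 1 - h + b - s * m, fun μ hμ => ?_⟩
    have hle : v μ ≤ u μ := by rw [hu μ hμ, hv μ hμ]; linarith [hS μ hμ]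
    rw [hu', hv', min_eq_right hle, max_eq_left hle, hu μ hμ, hv μ hμ]
    constructor
    · ring
    · linear_combination (-h) * htt
  · refine ⟨a, 1 - h + b, fun μ hμ => ?_⟩
    have hle : u μ ≤ v μ := by rw [hu μ hμ, hv μ hμ]; linarith [hS μ hμ]
    rw [hu', hv', min_eq_left hle, max_eq_right hle, hu μ hμ, hv μ hμ]
    constructor
    · ring
    · linear_combination (-h) * htt

/-- Each dyadic interval is half of a dyadic interval of the previous level. -/
lemma exists_dyadic_parent (n k : ℕ) (hk : k < 2 ^ (n + 1)) :
    ∃ q : ℕ, q < 2 ^ n ∧ ∃ t : ℝ, (t = 1 ∨ t = -1) ∧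
      (2 * (k : ℝ) + 1) / 2 ^ (n + 1) = (2 * q + 1) / 2 ^ n + t * (1 / 2 ^ (n + 1)) ∧
      ∀ μ ∈ Set.Icc (2 * (k : ℝ) / 2 ^ (n + 1)) (2 * (k + 1) / 2 ^ (n + 1)),
        0 ≤ t * (μ - (2 * q + 1) / 2 ^ n) ∧
          μ ∈ Set.Icc (2 * (q : ℝ) / 2 ^ n) (2 * (q + 1) / 2 ^ n) := by
  obtain ⟨h, hpos, hdiv, hdiv_succ⟩ : ∃ h : ℝ, 0 < h ∧ (∀ x : ℝ, x / 2 ^ n = x * h) ∧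
      ∀ x : ℝ, x / 2 ^ (n + 1) = x * (h / 2) :=
    ⟨1 / 2 ^ n, by positivity, fun x => by ring, fun x => by rw [pow_succ]; field_simp⟩
  rw [pow_succ] at hk
  simp only [hdiv, hdiv_succ, Set.mem_Icc]
  obtain ⟨q, rfl | rfl⟩ := k.even_or_odd'
  · refine ⟨q, by omega, -1, Or.inr rfl, by push_cast; ring, fun μ hμ => ?_⟩
    push_cast at hμ
    refine ⟨?_, ?_, ?_⟩ <;> linarith [hμ.1, hμ.2]
  · refine ⟨q, by omega, 1, Or.inl rfl, by push_cast; ring, fun μ hμ => ?_⟩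
    push_cast at hμ
    refine ⟨?_, ?_, ?_⟩ <;> linarith [hμ.1, hμ.2]

/-- Each coordinate of the tropical central path recursion is affine on each of the
`2^{r-1}` intervals `[k/2^{r-2}, (k+1)/2^{r-2}]` covering `[0,2]`; in particular the
curve `μ ↦ (f₁(μ), …, f_{2r}(μ))` restricted to `[0,2]` has at most `2^{r-1}` linear
pieces. -/
theorem tropical_central_path_piecewise_affine
    (r : ℕ) (hr : 2 ≤ r) (f : ℕ → ℝ → ℝ)
    (hf1 : ∀ μ : ℝ, f 1 μ = min μ 2)
    (hf2 : ∀ μ : ℝ, f 2 μ = 1)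
    (hfodd : ∀ j : ℕ, 1 ≤ j → j ≤ r - 1 → ∀ μ : ℝ,
      f (2 * j + 1) μ = 1 + min (f (2 * j - 1) μ) (f (2 * j) μ))
    (hfeven : ∀ j : ℕ, 1 ≤ j → j ≤ r - 1 → ∀ μ : ℝ,
      f (2 * j + 2) μ = (1 - 1 / 2 ^ j) + max (f (2 * j - 1) μ) (f (2 * j) μ)) :
    ∀ i : ℕ, 1 ≤ i → i ≤ 2 * r → ∀ k : ℕ, k ≤ 2 ^ (r - 1) - 1 →
      ∃ a b : ℝ, ∀ μ ∈ Set.Icc ((k : ℝ) / 2 ^ (r - 2)) (((k : ℝ) + 1) / 2 ^ (r - 2)),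
        f i μ = a * μ + b := by
  have key : ∀ n : ℕ, n + 1 ≤ r → ∀ k : ℕ, k < 2 ^ n →
      (∀ i, 1 ≤ i → i ≤ 2 * n + 2 → ∃ a b : ℝ,
        ∀ μ ∈ Set.Icc (2 * (k : ℝ) / 2 ^ n) (2 * (k + 1) / 2 ^ n), f i μ = a * μ + b) ∧
      ∃ a b s : ℝ, (s = 1 ∨ s = -1) ∧
        ∀ μ ∈ Set.Icc (2 * (k : ℝ) / 2 ^ n) (2 * (k + 1) / 2 ^ n),
          f (2 * n + 2) μ = a * μ + b ∧
          f (2 * n + 1) μ = a * μ + b + s * (μ - (2 * k + 1) / 2 ^ n) := by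
    intro n
    induction n with
    | zero =>
      intro _ k hk
      obtain rfl : k = 0 := by simpa using hk
      have hmin : ∀ μ ∈ Set.Icc (2 * ((0 : ℕ) : ℝ) / 2 ^ 0) (2 * (((0 : ℕ) : ℝ) + 1) / 2 ^ 0),
          f 1 μ = μ := by
        intro μ hμ
        rw [hf1, min_eq_left (by simpa using hμ.2)]
      refine ⟨fun i hi hi' => ?_, 0, 1, 1, Or.inl rfl, fun μ hμ => ⟨?_, ?_⟩⟩
      · obtain rfl | rfl : i = 1 ∨ i = 2 := by omega
        · exact ⟨1, 0, fun μ hμ => by rw [hmin μ hμ]; ring⟩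
        · exact ⟨0, 1, fun μ _ => by rw [hf2]; ring⟩
      · simp [hf2]
      · simp [hmin μ hμ]
    | succ n ih =>
      intro hn k hk
      obtain ⟨q, hq, t, ht, hcentre, hsub⟩ := exists_dyadic_parent n k hk
      obtain ⟨hprev, a, b, s, hs, hlast⟩ := ih (by omega) q hq
      have hodd := hfodd (n + 1) (by omega) (by omega)
      have heven := hfeven (n + 1) (by omega) (by omega)
      obtain ⟨a', b', hstep⟩ := exists_affine_min_max_of_half hs ht
        (fun μ hμ => (hsub μ hμ).1) (fun μ hμ => (hlast μ (hsub μ hμ).2).1)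
        (fun μ hμ => (hlast μ (hsub μ hμ).2).2) hodd heven
      rw [← hcentre] at hstep
      refine ⟨fun i hi hi' => ?_, a', b', -t, ?_, hstep⟩
      · rcases Nat.lt_or_ge (2 * n + 2) i with hlt | hle
        · obtain rfl | rfl : i = 2 * (n + 1) + 1 ∨ i = 2 * (n + 1) + 2 := by omega
          · exact ⟨a' - t, b' + t * ((2 * k + 1) / 2 ^ (n + 1)), fun μ hμ => by
              rw [(hstep μ hμ).2]; ring⟩
          · exact ⟨a', b', fun μ hμ => (hstep μ hμ).1⟩
        · obtain ⟨c, d, hcd⟩ := hprev i hi hle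
          exact ⟨c, d, fun μ hμ => hcd μ (hsub μ hμ).2⟩
      · rcases ht with rfl | rfl <;> norm_num
  intro i hi hi' k hk
  obtain ⟨m, rfl⟩ := Nat.exists_eq_add_of_le' hr
  have hpow : 0 < 2 ^ (m + 1) := by positivity
  obtain ⟨a, b, hab⟩ := (key (m + 1) (by omega) k (by
    rw [show m + 2 - 1 = m + 1 by omega] at hk; omega)).1 i hi (by omega)
  refine ⟨a, b, fun μ hμ => hab μ ?_⟩
  have hscale : ∀ x : ℝ, 2 * x / 2 ^ (m + 1) = x / 2 ^ m := by
    intro x; rw [pow_succ]; field_simp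
  rwa [hscale, hscale]
end

section
/- Let r ≥ 2 be an integer, and define functions f_1, …, f_{2r} : ℝ → ℝ by f_1(μ) = min(μ, 2), f_2(μ) = 1, and for 1 ≤ j ≤ r−1: f_{2j+1}(μ) = 1 + min(f_{2j−1}(μ), f_{2j}(μ)) and f_{2j+2}(μ) = (1 − 2^{−j}) + max(f_{2j−1}(μ), f_{2j}(μ)). Then for every integer 1 ≤ k ≤ 2^{r−1} − 1, the map ℝ → ℝ^{2r}, μ ↦ (f_1(μ), …, f_{2r}(μ)), is not differentiable at the point μ = k/2^{r−2}; consequently, the restriction of this piecewise-linear map to [0, 2] has exactly 2^{r−1} linear pieces. -/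
/-- The iterated tent maps `d (n + 1) = 2⁻⁽ⁿ⁺¹⁾ - |d n|`, starting from `μ - 1` on `[0, 2]`, have
slope `±1` and a zero at the midpoint on each dyadic interval of radius `2⁻ⁿ` in `[0, 2]`. -/
lemma iterated_tent_eq {N : ℕ} {d : ℕ → ℝ → ℝ} (h0 : ∀ μ ≤ 2, d 0 μ = μ - 1)
    (hsucc : ∀ n < N, ∀ μ, d (n + 1) μ = 1 / 2 ^ (n + 1) - |d n μ|) {n : ℕ} (hn : n ≤ N)
    {m : ℕ} (hm : m < 2 ^ n) :
    ∃ ε : ℝ, |ε| = 1 ∧ ∀ μ : ℝ, |μ - (2 * m + 1) / 2 ^ n| ≤ 1 / 2 ^ n →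
      d n μ = ε * (μ - (2 * m + 1) / 2 ^ n) := by
  induction n generalizing m with
  | zero =>
    obtain rfl : m = 0 := by simpa using hm
    refine ⟨1, by simp, fun μ hμ => ?_⟩
    have := (abs_le.1 hμ).2
    norm_num at this
    rw [h0 μ (by linarith)]
    norm_num
  | succ n ih =>
    have hpos : (0 : ℝ) < 1 / 2 ^ (n + 1) := by positivity
    have hhalf : (1 : ℝ) / 2 ^ n = 2 * (1 / 2 ^ (n + 1)) := by field_simp; ring
    obtain ⟨p, hp | hp⟩ := Nat.even_or_odd' m
    all_goals
      obtain ⟨ε, hε, h⟩ := ih (m := p) (by omega) (by rw [pow_succ] at hm; omega)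
      have hcenter : (2 * (p : ℝ) + 1) / 2 ^ n = (4 * p + 2) * (1 / 2 ^ (n + 1)) := by
        field_simp; ring
      have hcenter' : (2 * (m : ℝ) + 1) / 2 ^ (n + 1) = (2 * m + 1) * (1 / 2 ^ (n + 1)) := by
        ring
      simp only [hcenter, hhalf] at h
      simp only [hcenter']
      simp only [hp]
      push_cast
      have hstep := hsucc n (by omega)
      generalize (1 : ℝ) / 2 ^ (n + 1) = w at *
    · refine ⟨1, by simp, fun μ hμ => ?_⟩
      obtain ⟨h1, h2⟩ := abs_le.1 hμ
      rw [hstep, h μ (abs_le.2 ⟨by linarith, by linarith⟩), abs_mul, hε,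
        abs_of_nonpos (by linarith)]
      ring
    · refine ⟨-1, by simp, fun μ hμ => ?_⟩
      obtain ⟨h1, h2⟩ := abs_le.1 hμ
      rw [hstep, h μ (abs_le.2 ⟨by linarith, by linarith⟩), abs_mul, hε,
        abs_of_nonneg (by linarith)]
      ring

lemma min_eq_half_add_sub_abs (a b : ℝ) : min a b = (a + b - |a - b|) / 2 := by
  have h := min_add_max a b
  have h' := max_sub_min_eq_abs' a b
  linarith

/-- A dyadic interval of radius `2⁻⁽ⁿ⁺¹⁾` lies in its parent of radius `2⁻ⁿ`. -/
lemma dyadic_interval_subset {n m : ℕ} {μ : ℝ}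
    (hμ : |μ - (2 * m + 1) / 2 ^ (n + 1)| ≤ 1 / 2 ^ (n + 1)) :
    |μ - (2 * (m / 2 : ℕ) + 1) / 2 ^ n| ≤ 1 / 2 ^ n := by
  have hpos : (0 : ℝ) < 1 / 2 ^ (n + 1) := by positivity
  have hhalf : (1 : ℝ) / 2 ^ n = 2 * (1 / 2 ^ (n + 1)) := by field_simp; ring
  rw [div_eq_mul_one_div (2 * (m : ℝ) + 1)] at hμ
  rw [div_eq_mul_one_div, hhalf]
  generalize (1 : ℝ) / 2 ^ (n + 1) = w at *
  have h1 : (m : ℝ) ≤ 2 * (m / 2 : ℕ) + 1 := by exact_mod_cast (by omega : m ≤ 2 * (m / 2) + 1)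
  have h2 : 2 * ((m / 2 : ℕ) : ℝ) ≤ m := by exact_mod_cast (by omega : 2 * (m / 2) ≤ m)
  rw [abs_le] at hμ ⊢
  constructor <;> nlinarith

/-- The tropical central path `μ ↦ (f₁(μ), …, f_{2r}(μ))` is not differentiable at any
of the points `k/2^{r-2}` for `1 ≤ k ≤ 2^{r-1} - 1`; consequently, being affine on each
interval `[k/2^{r-2}, (k+1)/2^{r-2}]`, its restriction to `[0,2]` has exactly `2^{r-1}`
linear pieces. -/
theorem tropical_central_path_not_differentiable
    (r : ℕ) (hr : 2 ≤ r) (f : ℕ → ℝ → ℝ)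
    (hf1 : ∀ μ : ℝ, f 1 μ = min μ 2)
    (hf2 : ∀ μ : ℝ, f 2 μ = 1)
    (hfodd : ∀ j : ℕ, 1 ≤ j → j ≤ r - 1 → ∀ μ : ℝ,
      f (2 * j + 1) μ = 1 + min (f (2 * j - 1) μ) (f (2 * j) μ))
    (hfeven : ∀ j : ℕ, 1 ≤ j → j ≤ r - 1 → ∀ μ : ℝ,
      f (2 * j + 2) μ = (1 - 1 / 2 ^ j) + max (f (2 * j - 1) μ) (f (2 * j) μ)) :
    (∀ k : ℕ, 1 ≤ k → k ≤ 2 ^ (r - 1) - 1 →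
      ¬ DifferentiableAt ℝ (fun μ : ℝ => fun i : Fin (2 * r) => f ((i : ℕ) + 1) μ)
        ((k : ℝ) / 2 ^ (r - 2))) ∧
    (∀ i : ℕ, 1 ≤ i → i ≤ 2 * r → ∀ k : ℕ, k ≤ 2 ^ (r - 1) - 1 →
      ∃ a b : ℝ, ∀ μ ∈ Set.Icc ((k : ℝ) / 2 ^ (r - 2)) (((k : ℝ) + 1) / 2 ^ (r - 2)),
        f i μ = a * μ + b) := by
  set d : ℕ → ℝ → ℝ := fun n μ => f (2 * n + 1) μ - f (2 * n + 2) μ with hd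
  have hodd : ∀ n < r - 1, ∀ μ, f (2 * n + 3) μ = 1 + min (f (2 * n + 1) μ) (f (2 * n + 2) μ) :=
    fun n hn => hfodd (n + 1) (by omega) (by omega)
  have heven : ∀ n < r - 1, ∀ μ, f (2 * n + 4) μ =
      (1 - 1 / 2 ^ (n + 1)) + max (f (2 * n + 1) μ) (f (2 * n + 2) μ) :=
    fun n hn => hfeven (n + 1) (by omega) (by omega)
  have h0 : ∀ μ ≤ 2, d 0 μ = μ - 1 := fun μ hμ => by
    simp [hd, hf1, hf2, min_eq_left hμ]
  have hsucc : ∀ n < r - 1, ∀ μ, d (n + 1) μ = 1 / 2 ^ (n + 1) - |d n μ| := fun n hn μ => by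
    have := max_sub_min_eq_abs' (f (2 * n + 1) μ) (f (2 * n + 2) μ)
    change f (2 * n + 3) μ - f (2 * n + 4) μ = _ - |f (2 * n + 1) μ - f (2 * n + 2) μ|
    rw [hodd n hn, heven n hn]
    linarith
  refine ⟨fun k hk1 hk2 hdiff => ?_, ?_⟩
  · obtain ⟨s, q, ⟨m, rfl⟩, rfl⟩ := Nat.exists_eq_two_pow_mul_odd (n := k) (by omega)
    have hlt : 2 ^ s * (2 * m + 1) < 2 ^ (r - 1) := by
      have : 0 < 2 ^ (r - 1) := by positivity
      omega
    have hs : s < r - 1 := (Nat.pow_lt_pow_iff_right (a := 2) (by norm_num)).1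
      (lt_of_le_of_lt (Nat.le_mul_of_pos_right _ (by omega)) hlt)
    obtain ⟨n, hn⟩ : ∃ n, r = n + s + 2 := ⟨r - 2 - s, by omega⟩
    have hm : m < 2 ^ n := by
      have h : 2 ^ s * (2 * m + 1) < 2 ^ s * (2 * 2 ^ n) := by
        convert hlt using 1
        rw [show r - 1 = s + (n + 1) by omega]
        ring
      have := lt_of_mul_lt_mul_left' h
      omega
    have hcenter : ((2 ^ s * (2 * m + 1) : ℕ) : ℝ) / 2 ^ (r - 2) = (2 * m + 1) / 2 ^ n := by
      rw [show r - 2 = n + s by omega, pow_add]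
      push_cast
      field_simp
    rw [hcenter, differentiableAt_pi] at hdiff
    set c : ℝ := (2 * m + 1) / 2 ^ n
    obtain ⟨ε, hε, h⟩ := iterated_tent_eq h0 hsucc (n := n) (by omega) hm
    have hdiff_succ : DifferentiableAt ℝ (d (n + 1)) c :=
      (hdiff ⟨2 * n + 2, by omega⟩).sub (hdiff ⟨2 * n + 3, by omega⟩)
    have hev : (fun μ => |μ - c|) =ᶠ[nhds c] fun μ => 1 / 2 ^ (n + 1) - d (n + 1) μ := by
      filter_upwards [Metric.closedBall_mem_nhds c (show (0 : ℝ) < 1 / 2 ^ n by positivity)]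
        with μ hμ
      rw [hsucc n (by omega), h μ (by simpa [Real.dist_eq] using hμ), abs_mul, hε]
      ring
    have habs : DifferentiableAt ℝ (fun μ : ℝ => |μ - c|) c :=
      (hdiff_succ.const_sub _).congr_of_eventuallyEq hev
    refine not_differentiableAt_abs_zero ?_
    have hcomp : DifferentiableAt ℝ ((fun μ : ℝ => |μ - c|) ∘ fun x => x + c) 0 :=
      DifferentiableAt.comp 0 (by simpa using habs) (by fun_prop)
    simpa [Function.comp_def] using hcomp
  · have key : ∀ n ≤ r - 1, ∀ m : ℕ, m < 2 ^ n → ∀ i, 1 ≤ i → i ≤ 2 * n + 2 → ∃ a b : ℝ, ∀ μ : ℝ,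
        |μ - (2 * m + 1) / 2 ^ n| ≤ 1 / 2 ^ n → f i μ = a * μ + b := by
      intro n
      induction n with
      | zero =>
        intro _ m hm i hi1 hi2
        obtain rfl : m = 0 := by simpa using hm
        obtain rfl | rfl : i = 1 ∨ i = 2 := by omega
        · refine ⟨1, 0, fun μ hμ => ?_⟩
          have := (abs_le.1 hμ).2
          norm_num at this
          rw [hf1, min_eq_left (by linarith)]
          ring
        · exact ⟨0, 1, fun μ _ => by rw [hf2]; ring⟩
      | succ n ih =>
        intro hn m hm i hi1 hi2
        have hsub : ∀ μ : ℝ, |μ - (2 * m + 1) / 2 ^ (n + 1)| ≤ 1 / 2 ^ (n + 1) →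
            |μ - (2 * (m / 2 : ℕ) + 1) / 2 ^ n| ≤ 1 / 2 ^ n :=
          fun μ hμ => dyadic_interval_subset hμ
        have ih' := ih (by omega) (m / 2) (by rw [pow_succ] at hm; omega)
        obtain ⟨ε, -, h⟩ := iterated_tent_eq h0 hsucc hn hm
        obtain ⟨a, b, hab⟩ := ih' (2 * n + 1) (by omega) (by omega)
        obtain ⟨a', b', hab'⟩ := ih' (2 * n + 2) (by omega) (by omega)
        have hodd_affine : ∃ a b : ℝ, ∀ μ : ℝ,
            |μ - (2 * m + 1) / 2 ^ (n + 1)| ≤ 1 / 2 ^ (n + 1) → f (2 * n + 3) μ = a * μ + b := by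
          refine ⟨(a + a' + ε) / 2, 1 + (b + b' - 1 / 2 ^ (n + 1)
            - ε * ((2 * m + 1) / 2 ^ (n + 1))) / 2, fun μ hμ => ?_⟩
          have h1 := h μ hμ
          rw [hsucc n (by omega)] at h1
          have h2 := min_eq_half_add_sub_abs (f (2 * n + 1) μ) (f (2 * n + 2) μ)
          have h3 := hab μ (hsub μ hμ)
          have h4 := hab' μ (hsub μ hμ)
          change _ - |f (2 * n + 1) μ - f (2 * n + 2) μ| = _ at h1
          rw [hodd n (by omega), h2]
          linarith
        obtain hi | rfl | rfl : i ≤ 2 * n + 2 ∨ i = 2 * n + 3 ∨ i = 2 * n + 4 := by omega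
        · obtain ⟨a, b, hab⟩ := ih' i hi1 hi
          exact ⟨a, b, fun μ hμ => hab μ (hsub μ hμ)⟩
        · exact hodd_affine
        · obtain ⟨a, b, hab⟩ := hodd_affine
          refine ⟨a - ε, b + ε * ((2 * m + 1) / 2 ^ (n + 1)), fun μ hμ => ?_⟩
          have h1 : f (2 * n + 3) μ - f (2 * n + 4) μ = _ := h μ hμ
          have h2 := hab μ hμ
          linarith
    intro i hi1 hi2 k hk
    have hpos : 0 < 2 ^ (r - 1) := by positivity
    obtain ⟨a, b, hab⟩ := key (r - 1) le_rfl k (by omega) i hi1 (by omega)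
    refine ⟨a, b, fun μ hμ => hab μ ?_⟩
    obtain ⟨h1, h2⟩ := hμ
    obtain ⟨t, rfl⟩ : ∃ t, r = t + 2 := ⟨r - 2, by omega⟩
    simp only [Nat.add_sub_cancel, show t + 2 - 1 = t + 1 by omega] at *
    have e1 : (k : ℝ) / 2 ^ t = (2 * k + 1) / 2 ^ (t + 1) - 1 / 2 ^ (t + 1) := by
      field_simp; ring
    have e2 : ((k : ℝ) + 1) / 2 ^ t = (2 * k + 1) / 2 ^ (t + 1) + 1 / 2 ^ (t + 1) := by
      field_simp; ring
    exact abs_le.2 ⟨by linarith, by linarith⟩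
end
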